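/- Let S = (X, Y, Z, W) be the M₄(2,3) balanced excited random walk, τ_k the successive times at which (Z, W) moves, M_m := X_{τ_m}, and under the conditional law P_U given the whole process U let V be the quadratic variation of the martingale M. Let r_U(n) be the cardinality of the range of U at time n, t_k := n − n/2^k, and 𝒦 := { k ∈ {1,…,(log n)^{3/4}} : r_U(t_{k+1}) − r_U(t_k) ≥ ρ₀·(t_{k+1} − t_k)/log n }. Then for every k ∈ 𝒦, V_{t_{k+1}} − V_{t_k} ≥ (r_U(t_{k+1}) − r_U(t_k) − 1)/2 ≥ (ρ₀/4)·(t_{k+1} − t_k)/log n; in particular each time U is at a newly visited site, E_U[(M_{n+1} − M_n)² | 𝒢_n] ≥ 1/2. -/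

import Mathlib

open MeasureTheory Filter

/-- The `i`-th canonical unit vector of `ℤ^d`. -/
def unitVec (d : ℕ) (i : Fin d) : Fin d → ℤ := fun j => if j = i then 1 else 0

/-- `S` is a balanced excited random walk `M_d(d₁,d₂)` under `P`:
it starts at `0` a.s., is measurable, and conditionally on any finite trajectory
`S_0 = h 0, …, S_n = h n`, if `h n` is a new site the walk jumps to `h n ± e_i`
with probability `1/(2d₁)` for each `i < d₁` (`0`-indexed), while if `h n` is an
old site it jumps to `h n ± e_i` with probability `1/(2d₂)` for each
`d - d₂ ≤ i < d` (`0`-indexed). -/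
def IsBERW {Ω : Type*} [MeasurableSpace Ω] (d d₁ d₂ : ℕ) (P : Measure Ω)
    (S : ℕ → Ω → Fin d → ℤ) : Prop :=
  (∀ n, Measurable (S n)) ∧
  (∀ᵐ ω ∂P, S 0 ω = 0) ∧
  (∀ (n : ℕ) (h : ℕ → Fin d → ℤ), (∀ k < n, h n ≠ h k) →
    ∀ i : Fin d, i.1 < d₁ → ∀ ε : ℤ, ε = 1 ∨ ε = -1 →
      P {ω | (∀ k ≤ n, S k ω = h k) ∧ S (n + 1) ω = h n + ε • unitVec d i}
        = P {ω | ∀ k ≤ n, S k ω = h k} / (2 * d₁)) ∧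
  (∀ (n : ℕ) (h : ℕ → Fin d → ℤ), (∃ k < n, h n = h k) →
    ∀ i : Fin d, d - d₂ ≤ i.1 → ∀ ε : ℤ, ε = 1 ∨ ε = -1 →
      P {ω | (∀ k ≤ n, S k ω = h k) ∧ S (n + 1) ω = h n + ε • unitVec d i}
        = P {ω | ∀ k ≤ n, S k ω = h k} / (2 * d₂))

/-- Transience: almost surely, every site is visited only finitely many times. -/
def IsTransientWalk {Ω : Type*} [MeasurableSpace Ω] (d : ℕ) (P : Measure Ω)
    (S : ℕ → Ω → Fin d → ℤ) : Prop :=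
  ∀ᵐ ω ∂P, ∀ x : Fin d → ℤ, {n : ℕ | S n ω = x}.Finite

/-- `τ_k`: the successive times at which the pair of the last two coordinates
`(Z, W)` of the walk moves (`τ_0 = 0`). -/
noncomputable def tau {Ω : Type*} (S : ℕ → Ω → Fin 4 → ℤ) : ℕ → Ω → ℕ
  | 0 => fun _ => 0
  | k + 1 => fun ω => sInf {n : ℕ | tau S k ω < n ∧
      ¬(S n ω 2 = S (n - 1) ω 2 ∧ S n ω 3 = S (n - 1) ω 3)}

/-- `M_m := X_{τ_m}`, the first coordinate of the walk observed at the times `τ`. -/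
noncomputable def MartM {Ω : Type*} (S : ℕ → Ω → Fin 4 → ℤ) (m : ℕ) (ω : Ω) : ℝ :=
  (S (tau S m ω) ω 0 : ℝ)

/-- The integer valued version of `M_m = X_{τ_m}`. -/
noncomputable def MartMZ {Ω : Type*} (S : ℕ → Ω → Fin 4 → ℤ) (m : ℕ) (ω : Ω) : ℤ :=
  S (tau S m ω) ω 0

/-- `U_k := (Z_{τ_k}, W_{τ_k})`, a simple symmetric random walk on `ℤ²`. -/
noncomputable def Uproc {Ω : Type*} (S : ℕ → Ω → Fin 4 → ℤ) (k : ℕ) (ω : Ω) : ℤ × ℤ :=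
  (S (tau S k ω) ω 2, S (tau S k ω) ω 3)

/-- The σ-algebra generated by the whole process `U`; conditional expectation
given it realizes conditioning on `U` (the conditional law `P_U`). -/
noncomputable def sigmaU {Ω : Type*} [MeasurableSpace Ω]
    (S : ℕ → Ω → Fin 4 → ℤ) : MeasurableSpace Ω :=
  MeasurableSpace.comap (fun ω => fun k : ℕ => Uproc S k ω) inferInstance

/-- `𝒢_m = 𝔽_{τ_m}`: the σ-algebra generated by the trajectory of the walk
stopped at `τ_m` (together with `τ_m`), i.e. the natural filtration of `S`
sampled at the stopping time `τ_m`. -/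
noncomputable def stoppedSigma {Ω : Type*} [MeasurableSpace Ω]
    (S : ℕ → Ω → Fin 4 → ℤ) (m : ℕ) : MeasurableSpace Ω :=
  MeasurableSpace.comap
    (fun ω => (tau S m ω, fun k : ℕ => S (min k (tau S m ω)) ω)) inferInstance

/-- `r_U(n)`: the cardinality of the range `{U_0, …, U_n}` of `U` at time `n`. -/
noncomputable def rangeCardU {Ω : Type*} (S : ℕ → Ω → Fin 4 → ℤ)
    (n : ℕ) (ω : Ω) : ℕ :=
  ((Finset.range (n + 1)).image (fun k => Uproc S k ω)).card

/-- `t_k := n − n/2^k` (with natural division). -/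
def timeIdx (n k : ℕ) : ℕ := n - n / 2 ^ k

open scoped Classical in
/-- The set `𝒦 = {k ∈ {1,…,(log n)^{3/4}} :
r_U(t_{k+1}) − r_U(t_k) ≥ ρ₀ (t_{k+1} − t_k)/log n}`. -/
noncomputable def goodScalesU {Ω : Type*} (S : ℕ → Ω → Fin 4 → ℤ)
    (ρ₀ : ℝ) (n : ℕ) (ω : Ω) : Finset ℕ :=
  (Finset.Icc 1 ⌊(Real.log n) ^ ((3 : ℝ) / 4)⌋₊).filter
    (fun k => ρ₀ * ((timeIdx n (k + 1) : ℝ) - timeIdx n k) / Real.log n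
      ≤ (rangeCardU S (timeIdx n (k + 1)) ω : ℝ) - rangeCardU S (timeIdx n k) ω)

/-- The quadratic variation, under the conditional law `P_U`, of the martingale
`M_m = X_{τ_m}`: `V_n = ∑_{m=1}^n E_U[(M_m − M_{m−1})² | 𝒢_{m−1}]`. -/
noncomputable def quadVarU {Ω : Type*} [MeasurableSpace Ω] (P : Measure Ω)
    (S : ℕ → Ω → Fin 4 → ℤ) (n : ℕ) (ω : Ω) : ℝ :=
  ∑ m ∈ Finset.range n,
    (P[(fun ω' => (MartM S (m + 1) ω' - MartM S m ω') ^ 2)|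
        stoppedSigma S m ⊔ sigmaU S]) ω

namespace BERW

open scoped ENNReal

section Trajectories

/-- The steps allowed from a new site. -/
def newSteps : Finset (Fin 4 → ℤ) :=
  {unitVec 4 0, (-1 : ℤ) • unitVec 4 0, unitVec 4 1, (-1 : ℤ) • unitVec 4 1}

/-- The steps allowed from an old site. -/
def oldSteps : Finset (Fin 4 → ℤ) :=
  {unitVec 4 1, (-1 : ℤ) • unitVec 4 1, unitVec 4 2, (-1 : ℤ) • unitVec 4 2,
    unitVec 4 3, (-1 : ℤ) • unitVec 4 3}

/-- A step is vertical when it moves one of the last two coordinates. -/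
def IsVert (d : Fin 4 → ℤ) : Prop := ¬(d 2 = 0 ∧ d 3 = 0)

instance : DecidablePred IsVert := fun d => inferInstanceAs (Decidable (¬(d 2 = 0 ∧ d 3 = 0)))

lemma card_newSteps : newSteps.card = 4 := by decide

lemma card_oldSteps : oldSteps.card = 6 := by decide

variable {Ω : Type*} {S : ℕ → Ω → Fin 4 → ℤ}

/-- The step performed between the times `n` and `n + 1`. -/
def step (S : ℕ → Ω → Fin 4 → ℤ) (n : ℕ) (ω : Ω) : Fin 4 → ℤ := S (n + 1) ω - S n ω

/-- The walk follows the history `h` up to time `n`. -/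
def pathEvent (S : ℕ → Ω → Fin 4 → ℤ) (n : ℕ) (h : ℕ → Fin 4 → ℤ) : Set Ω :=
  {ω | ∀ k ≤ n, S k ω = h k}

/-- The event `E` depends on the trajectory up to time `n` only. -/
def DeterminedBy (S : ℕ → Ω → Fin 4 → ℤ) (n : ℕ) (E : Set Ω) : Prop :=
  ∀ ω ω', (∀ k ≤ n, S k ω = S k ω') → ω ∈ E → ω' ∈ E

/-- The step after time `n` is vertical. -/
def vertMove (S : ℕ → Ω → Fin 4 → ℤ) (n : ℕ) : Set Ω := {ω | IsVert (step S n ω)}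

/-- No step between the times `r` and `s` is vertical. -/
def noMove (S : ℕ → Ω → Fin 4 → ℤ) (r s : ℕ) : Set Ω :=
  {ω | ∀ k, r ≤ k → k < s → ω ∉ vertMove S k}

/-- Trajectories with legal steps and infinitely many vertical steps. -/
def goodSet (S : ℕ → Ω → Fin 4 → ℤ) : Set Ω :=
  {ω | (∀ n, step S n ω ∈ newSteps ∪ oldSteps) ∧ ∀ n, ∃ m, n ≤ m ∧ ω ∈ vertMove S m}

lemma determinedBy_pathEvent (n : ℕ) (h : ℕ → Fin 4 → ℤ) :
    DeterminedBy S n (pathEvent S n h) :=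
  fun _ _ hω hE k hk => (hω k hk).symm.trans (hE k hk)

lemma DeterminedBy.mono {n m : ℕ} (hnm : n ≤ m) {E : Set Ω} (hE : DeterminedBy S n E) :
    DeterminedBy S m E :=
  fun ω ω' h => hE ω ω' fun k hk => h k (hk.trans hnm)

lemma DeterminedBy.inter {n : ℕ} {E F : Set Ω} (hE : DeterminedBy S n E)
    (hF : DeterminedBy S n F) : DeterminedBy S n (E ∩ F) :=
  fun ω ω' h hω => ⟨hE ω ω' h hω.1, hF ω ω' h hω.2⟩

lemma determinedBy_step {n m : ℕ} (hnm : n < m) (C : (Fin 4 → ℤ) → Prop) :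
    DeterminedBy S m {ω | C (step S n ω)} := by
  intro ω ω' h hω
  simpa only [Set.mem_ofPred_eq, step, h n hnm.le, h (n + 1) hnm] using hω

lemma determinedBy_noMove (r s : ℕ) : DeterminedBy S s (noMove S r s) := by
  intro ω ω' h hω k hr hk hk'
  refine hω k hr hk ?_
  simpa only [vertMove, Set.mem_ofPred_eq, step, h k hk.le, h (k + 1) hk] using hk'

lemma mem_vertMove_iff {n : ℕ} {ω : Ω} :
    ω ∈ vertMove S n ↔ ¬(S (n + 1) ω 2 = S n ω 2 ∧ S (n + 1) ω 3 = S n ω 3) := by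
  simp [vertMove, IsVert, step, sub_eq_zero]

section Tau

lemma tau_succ_eq {k s : ℕ} {ω : Ω} (h1 : tau S k ω ≤ s) (h2 : ω ∈ noMove S (tau S k ω) s)
    (h3 : ω ∈ vertMove S s) : tau S (k + 1) ω = s + 1 := by
  have hmem : s + 1 ∈ {n : ℕ | tau S k ω < n ∧
      ¬(S n ω 2 = S (n - 1) ω 2 ∧ S n ω 3 = S (n - 1) ω 3)} :=
    ⟨by omega, by simpa using mem_vertMove_iff.1 h3⟩
  refine le_antisymm (Nat.sInf_le hmem) ?_
  obtain ⟨h4, h5⟩ := Nat.sInf_mem ⟨_, hmem⟩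
  by_contra! hlt
  change tau S (k + 1) ω < s + 1 at hlt
  change tau S k ω < tau S (k + 1) ω at h4
  change ¬(S (tau S (k + 1) ω) ω 2 = S (tau S (k + 1) ω - 1) ω 2 ∧
    S (tau S (k + 1) ω) ω 3 = S (tau S (k + 1) ω - 1) ω 3) at h5
  obtain ⟨m, hm⟩ : ∃ m, tau S (k + 1) ω = m + 1 := ⟨tau S (k + 1) ω - 1, by omega⟩
  refine h2 m (by omega) (by omega) (mem_vertMove_iff.2 ?_)
  simpa only [hm, Nat.add_sub_cancel] using h5

lemma exists_tau_succ {ω : Ω} (hω : ω ∈ goodSet S) (k : ℕ) :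
    ∃ s, tau S (k + 1) ω = s + 1 ∧ tau S k ω ≤ s ∧ ω ∈ noMove S (tau S k ω) s ∧
      ω ∈ vertMove S s := by
  classical
  have hex : ∃ m, tau S k ω ≤ m ∧ ω ∈ vertMove S m := hω.2 (tau S k ω)
  have h1 := Nat.find_spec hex
  have h2 : ω ∈ noMove S (tau S k ω) (Nat.find hex) := fun j hj hj' hv =>
    Nat.find_min hex hj' ⟨hj, hv⟩
  exact ⟨_, tau_succ_eq h1.1 h2 h1.2, h1.1, h2, h1.2⟩

lemma tau_mono {ω : Ω} (hω : ω ∈ goodSet S) : Monotone fun k => tau S k ω := by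
  refine monotone_nat_of_le_succ fun k => ?_
  obtain ⟨s, h, h', -⟩ := exists_tau_succ hω k
  omega

lemma tau_congr {ω ω' : Ω} (hω : ω ∈ goodSet S) (n : ℕ)
    (h : ∀ k ≤ tau S n ω, S k ω = S k ω') : ∀ j ≤ n, tau S j ω' = tau S j ω := by
  induction n with
  | zero => intro j hj; obtain rfl : j = 0 := by omega
            rfl
  | succ n ih =>
    obtain ⟨s, h1, h2, h3, h4⟩ := exists_tau_succ hω n
    have ih' := ih fun k hk => h k (by omega)
    intro j hj
    rcases hj.lt_or_eq with hj | rfl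
    · exact ih' j (by omega)
    · have hn := ih' n le_rfl
      rw [h1]
      refine tau_succ_eq (hn.le.trans h2) ?_ ?_
      · rw [hn]
        exact determinedBy_noMove _ _ ω ω' (fun k hk => h k (by omega)) h3
      · exact determinedBy_step (Nat.lt_succ_self s) IsVert ω ω' (fun k hk => h k (by omega)) h4

lemma vert_eq_of_noMove {ω : Ω} {r s : ℕ} (h : ω ∈ noMove S r s) {k : ℕ} (hr : r ≤ k)
    (hs : k ≤ s) : (S k ω 2, S k ω 3) = (S r ω 2, S r ω 3) := by
  induction k, hr using Nat.le_induction with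
  | base => rfl
  | succ k hk ih =>
    rw [← ih (by omega)]
    have := h k hk (by omega)
    rw [mem_vertMove_iff, not_not] at this
    simp [this.1, this.2]

lemma noMove_mono {r s s' : ℕ} (h : s' ≤ s) : noMove S r s ⊆ noMove S r s' :=
  fun _ hω k hr hs => hω k hr (hs.trans_le h)

lemma exists_Uproc_eq {ω : Ω} (hω : ω ∈ goodSet S) (n : ℕ) {k : ℕ} (hk : k < tau S n ω) :
    ∃ j < n, (S k ω 2, S k ω 3) = Uproc S j ω := by
  induction n with
  | zero => exact absurd hk (Nat.not_lt_zero k)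
  | succ n ih =>
    obtain ⟨s, h1, h2, h3, -⟩ := exists_tau_succ hω n
    rcases lt_or_ge k (tau S n ω) with h | h
    · obtain ⟨j, hj, hj'⟩ := ih h
      exact ⟨j, by omega, hj'⟩
    · exact ⟨n, by omega, vert_eq_of_noMove h3 h (by omega)⟩

lemma site_new_of_Uproc_new {ω : Ω} (hω : ω ∈ goodSet S) {n : ℕ}
    (hn : ∀ k < n, Uproc S n ω ≠ Uproc S k ω) :
    ∀ k < tau S n ω, S (tau S n ω) ω ≠ S k ω := by
  intro k hk heq
  obtain ⟨j, hj, hj'⟩ := exists_Uproc_eq hω n hk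
  exact hn j hj (by rw [← hj', ← heq]; rfl)

lemma abs_step_zero_le {ω : Ω} (hω : ω ∈ goodSet S) (n : ℕ) : |(step S n ω 0 : ℝ)| ≤ 1 := by
  have key : ∀ d ∈ newSteps ∪ oldSteps, |d 0| ≤ 1 := by decide
  exact_mod_cast key _ (hω.1 n)

lemma step_zero_eq_zero {ω : Ω} (hω : ω ∈ goodSet S) {n : ℕ} (hn : ω ∈ vertMove S n) :
    step S n ω 0 = 0 := by
  have key : ∀ d ∈ newSteps ∪ oldSteps, IsVert d → d 0 = 0 := by decide
  exact key _ (hω.1 n) hn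

lemma abs_sub_le {ω : Ω} (hω : ω ∈ goodSet S) (r k : ℕ) :
    |((S (r + k) ω 0 : ℤ) : ℝ) - (S r ω 0 : ℤ)| ≤ k := by
  induction k with
  | zero => simp
  | succ k ih =>
    have h := abs_step_zero_le hω (r + k)
    simp only [step, Pi.sub_apply, Int.cast_sub] at h
    rw [← add_assoc]
    push_cast
    rw [abs_le] at *
    constructor <;> linarith [h.1, h.2, ih.1, ih.2]

end Tau

end Trajectories

section Steps

variable {Ω : Type*} [MeasurableSpace Ω] {P : Measure Ω} {S : ℕ → Ω → Fin 4 → ℤ}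

lemma measure_inter_of_uniform [IsFiniteMeasure P] {A : Set Ω}
    {f : Ω → Fin 4 → ℤ} (hf : Measurable f) {s : Finset (Fin 4 → ℤ)} (hs : s.Nonempty)
    (h : ∀ d ∈ s, P (A ∩ {ω | f ω = d}) = P A / s.card) (C : (Fin 4 → ℤ) → Prop)
    [DecidablePred C] :
    P (A ∩ {ω | C (f ω)}) = (s.filter C).card * (P A / s.card) := by
  set ν : Measure (Fin 4 → ℤ) := (P.restrict A).map f with hν
  have hνap : ∀ T : Set (Fin 4 → ℤ), ν T = P (A ∩ f ⁻¹' T) := fun T => by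
    have hT : MeasurableSet T := T.to_countable.measurableSet
    rw [hν, Measure.map_apply hf hT, Measure.restrict_apply (hf hT), Set.inter_comm]
  have hsing : ∀ d ∈ s, ν {d} = P A / s.card := fun d hd => by
    rw [hνap, ← h d hd]; rfl
  have hsum : ∀ t ⊆ s, ν t = t.card * (P A / s.card) := fun t ht => by
    rw [← sum_measure_singleton, Finset.sum_congr rfl fun d hd => hsing d (ht hd),
      Finset.sum_const, nsmul_eq_mul]
  have hfull : ν s = ν Set.univ := by
    rw [hsum s subset_rfl, hνap, Set.preimage_univ, Set.inter_univ]
    exact ENNReal.mul_div_cancel (by simpa using hs.ne_empty) (by simp)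
  have hcompl : ν (s : Set (Fin 4 → ℤ))ᶜ = 0 := by
    have := measure_compl (μ := ν) s.measurableSet (measure_ne_top _ _)
    rw [this, hfull, tsub_self]
  have hC : ν {d | C d} = ν (s.filter C : Finset (Fin 4 → ℤ)) := by
    refine measure_congr ?_
    filter_upwards [mem_ae_iff.2 (by rwa [compl_compl] : ν ((s : Set (Fin 4 → ℤ))ᶜᶜᶜ) = 0)]
      with d hd
    rw [compl_compl] at hd
    refine propext ?_
    change C d ↔ d ∈ (s.filter C : Finset _)
    simp [Finset.mem_coe.1 hd]
  rw [← hsum _ (Finset.filter_subset _ _), ← hC, hνap]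
  rfl

section Determined

variable (hS : ∀ n, Measurable (S n))
include hS

lemma measurable_step (n : ℕ) : Measurable (step S n) := (hS (n + 1)).sub (hS n)

lemma measurableSet_pathEvent (n : ℕ) (h : ℕ → Fin 4 → ℤ) :
    MeasurableSet (pathEvent S n h) := by
  have : pathEvent S n h = ⋂ k, ⋂ (_ : k ≤ n), S k ⁻¹' {h k} := by
    ext ω; simp [pathEvent]
  rw [this]
  exact MeasurableSet.iInter fun k => MeasurableSet.iInter fun _ => hS k (measurableSet_singleton _)

lemma measurableSet_step (n : ℕ) (C : (Fin 4 → ℤ) → Prop) :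
    MeasurableSet {ω | C (step S n ω)} :=
  measurable_step hS n (Set.to_countable {d | C d}).measurableSet

omit [MeasurableSpace Ω] hS in
lemma DeterminedBy.exists_preimage {n : ℕ} {E : Set Ω} (hE : DeterminedBy S n E) :
    ∃ T : Set (Fin (n + 1) → Fin 4 → ℤ), E = (fun ω (i : Fin (n + 1)) => S i ω) ⁻¹' T := by
  refine ⟨(fun ω (i : Fin (n + 1)) => S i ω) '' E, Set.Subset.antisymm
    (Set.subset_preimage_image _ _) ?_⟩
  rintro ω ⟨ω', hω', h⟩
  exact hE ω' ω (fun k hk => congrFun h ⟨k, by omega⟩) hω'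

lemma measurable_prefix (n : ℕ) : Measurable (fun ω (i : Fin (n + 1)) => S i ω) :=
  measurable_pi_iff.2 fun i => hS i

lemma DeterminedBy.measurableSet {n : ℕ} {E : Set Ω} (hE : DeterminedBy S n E) :
    MeasurableSet E := by
  obtain ⟨T, rfl⟩ := hE.exists_preimage
  exact measurable_prefix hS n T.to_countable.measurableSet

/-- Comparison of two measures on the past of time `n` from their comparison on histories. -/
lemma DeterminedBy.measure_le {μ ν : Measure Ω} {n : ℕ} {E : Set Ω} (hE : DeterminedBy S n E)
    (h : ∀ g, μ (pathEvent S n g) ≤ ν (pathEvent S n g)) : μ E ≤ ν E := by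
  obtain ⟨T, rfl⟩ := hE.exists_preimage
  have hm : ∀ a ∈ T, MeasurableSet ((fun ω (i : Fin (n + 1)) => S i ω) ⁻¹' {a}) :=
    fun a _ => measurable_prefix hS n (measurableSet_singleton a)
  rw [← tsum_measure_preimage_singleton T.to_countable hm,
    ← tsum_measure_preimage_singleton T.to_countable hm]
  refine ENNReal.tsum_le_tsum fun a => ?_
  convert h fun k => if hk : k < n + 1 then a.1 ⟨k, hk⟩ else 0 using 2 <;>
  · ext ω
    simp only [pathEvent, Set.mem_preimage, Set.mem_singleton_iff, funext_iff,
      Set.mem_ofPred_eq]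
    constructor
    · intro H k hk i
      rw [dif_pos (by omega)]
      exact H ⟨k, by omega⟩ i
    · intro H k i
      have := H k (by omega) i
      rwa [dif_pos k.2] at this

lemma DeterminedBy.mul_measure_inter_le {n : ℕ} {E B C : Set Ω} (hE : DeterminedBy S n E)
    {b c : ℝ≥0∞}
    (h : ∀ g, b * P (pathEvent S n g ∩ B) ≤ c * P (pathEvent S n g ∩ C)) :
    b * P (E ∩ B) ≤ c * P (E ∩ C) := by
  have := hE.measure_le hS (μ := b • P.restrict B) (ν := c • P.restrict C) fun g => by
    simpa [Measure.restrict_apply (measurableSet_pathEvent hS n g)] using h g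
  simpa [Measure.restrict_apply (hE.measurableSet hS)] using this

lemma DeterminedBy.mul_measure_inter_eq {n : ℕ} {E B C : Set Ω} (hE : DeterminedBy S n E)
    {b c : ℝ≥0∞}
    (h : ∀ g, b * P (pathEvent S n g ∩ B) = c * P (pathEvent S n g ∩ C)) :
    b * P (E ∩ B) = c * P (E ∩ C) :=
  le_antisymm (hE.mul_measure_inter_le hS fun g => (h g).le)
    (hE.mul_measure_inter_le hS fun g => (h g).ge)

end Determined

omit [MeasurableSpace Ω] in
lemma pathEvent_inter_step (n : ℕ) (h : ℕ → Fin 4 → ℤ) (d : Fin 4 → ℤ) :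
    pathEvent S n h ∩ {ω | step S n ω = d}
      = {ω | (∀ k ≤ n, S k ω = h k) ∧ S (n + 1) ω = h n + d} := by
  ext ω
  simp only [pathEvent, Set.mem_inter_iff, Set.mem_ofPred_eq, step, sub_eq_iff_eq_add]
  refine and_congr_right fun hω => ?_
  rw [hω n le_rfl, add_comm d]

section StepLaw

variable [IsFiniteMeasure P] (hS : IsBERW 4 2 3 P S)
include hS

lemma step_law_new (n : ℕ) (h : ℕ → Fin 4 → ℤ) (hn : ∀ k < n, h n ≠ h k)
    (C : (Fin 4 → ℤ) → Prop) [DecidablePred C] :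
    P (pathEvent S n h ∩ {ω | C (step S n ω)})
      = (newSteps.filter C).card * (P (pathEvent S n h) / 4) := by
  have key : ∀ d ∈ newSteps, P (pathEvent S n h ∩ {ω | step S n ω = d})
      = P (pathEvent S n h) / newSteps.card := by
    have aux : ∀ d ∈ newSteps, ∃ i : Fin 4, i.1 < 2 ∧ ∃ ε : ℤ, (ε = 1 ∨ ε = -1) ∧
        d = ε • unitVec 4 i := by
      simp only [newSteps, Finset.mem_insert, Finset.mem_singleton]
      rintro d (rfl | rfl | rfl | rfl)
      exacts [⟨0, by decide, 1, by simp, by simp⟩, ⟨0, by decide, -1, by simp, rfl⟩,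
        ⟨1, by decide, 1, by simp, by simp⟩, ⟨1, by decide, -1, by simp, rfl⟩]
    intro d hd
    obtain ⟨i, hi, ε, hε, rfl⟩ := aux d hd
    have := hS.2.2.1 n h hn i hi ε hε
    rw [card_newSteps]
    have h4 : ((2 : ℝ≥0∞) * (2 : ℕ)) = (4 : ℕ) := by norm_num
    rw [pathEvent_inter_step, ← h4, this]
    rfl
  have := measure_inter_of_uniform
    (measurable_step hS.1 n) (s := newSteps) (by decide) key C
  rwa [card_newSteps] at this

lemma step_law_old (n : ℕ) (h : ℕ → Fin 4 → ℤ) (hn : ∃ k < n, h n = h k)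
    (C : (Fin 4 → ℤ) → Prop) [DecidablePred C] :
    P (pathEvent S n h ∩ {ω | C (step S n ω)})
      = (oldSteps.filter C).card * (P (pathEvent S n h) / 6) := by
  have key : ∀ d ∈ oldSteps, P (pathEvent S n h ∩ {ω | step S n ω = d})
      = P (pathEvent S n h) / oldSteps.card := by
    have aux : ∀ d ∈ oldSteps, ∃ i : Fin 4, 4 - 3 ≤ i.1 ∧ ∃ ε : ℤ, (ε = 1 ∨ ε = -1) ∧
        d = ε • unitVec 4 i := by
      simp only [oldSteps, Finset.mem_insert, Finset.mem_singleton]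
      rintro d (rfl | rfl | rfl | rfl | rfl | rfl)
      exacts [⟨1, by decide, 1, by simp, by simp⟩, ⟨1, by decide, -1, by simp, rfl⟩,
        ⟨2, by decide, 1, by simp, by simp⟩, ⟨2, by decide, -1, by simp, rfl⟩,
        ⟨3, by decide, 1, by simp, by simp⟩, ⟨3, by decide, -1, by simp, rfl⟩]
    intro d hd
    obtain ⟨i, hi, ε, hε, rfl⟩ := aux d hd
    have := hS.2.2.2 n h hn i hi ε hε
    rw [card_oldSteps]
    have h6 : ((2 : ℝ≥0∞) * (3 : ℕ)) = (6 : ℕ) := by norm_num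
    rw [pathEvent_inter_step, ← h6, this]
    rfl
  have := measure_inter_of_uniform
    (measurable_step hS.1 n) (s := oldSteps) (by decide) key C
  rwa [card_oldSteps] at this

/-- An identity between the numbers of steps of two kinds, valid for both sets of steps,
turns into an identity between probabilities. -/
lemma measure_step_eq {n : ℕ} {E : Set Ω} (hE : DeterminedBy S n E) {b c : ℝ≥0∞}
    (B C : (Fin 4 → ℤ) → Prop) [DecidablePred B] [DecidablePred C]
    (h1 : b * (newSteps.filter B).card = c * (newSteps.filter C).card)
    (h2 : b * (oldSteps.filter B).card = c * (oldSteps.filter C).card) :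
    b * P (E ∩ {ω | B (step S n ω)}) = c * P (E ∩ {ω | C (step S n ω)}) := by
  refine hE.mul_measure_inter_eq hS.1 fun g => ?_
  by_cases hg : ∃ k < n, g n = g k
  · rw [step_law_old hS n g hg, step_law_old hS n g hg, ← mul_assoc, h2, mul_assoc]
  · push Not at hg
    rw [step_law_new hS n g hg, step_law_new hS n g hg, ← mul_assoc, h1, mul_assoc]

end StepLaw

end Steps

section Confinement

variable {Ω : Type*} [MeasurableSpace Ω] {P : Measure Ω} [IsProbabilityMeasure P]
  {S : ℕ → Ω → Fin 4 → ℤ} (hS : IsBERW 4 2 3 P S)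
include hS

lemma two_mul_le_vertMove (n : ℕ) (h : ℕ → Fin 4 → ℤ) (hn : ∃ k < n, h n = h k) :
    2 * P (pathEvent S n h) ≤ 3 * P (pathEvent S n h ∩ vertMove S n) := by
  have h1 := step_law_old hS n h hn IsVert
  rw [show (oldSteps.filter IsVert).card = 4 by decide] at h1
  have h2 : P (pathEvent S n h) = P (pathEvent S n h) / 6 * 6 :=
    (ENNReal.div_mul_cancel (by norm_num) (by norm_num)).symm
  have h3 : P (pathEvent S n h ∩ vertMove S n) = _ := h1
  rw [h3]
  nth_rw 1 [h2]
  refine le_of_eq ?_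
  push_cast
  ring

lemma le_six_mul_of_step (r : ℕ) (h : ℕ → Fin 4 → ℤ) (hd : h (r + 1) - h r ∈ newSteps) :
    P (pathEvent S (r + 1) h) ≤ 6 * P (pathEvent S (r + 1) h ∩ (noMove S r (r + 3))ᶜ) := by
  by_cases hold : ∃ k < r + 1, h (r + 1) = h k
  · have h1 := two_mul_le_vertMove hS (r + 1) h hold
    have h2 : P (pathEvent S (r + 1) h ∩ vertMove S (r + 1))
        ≤ P (pathEvent S (r + 1) h ∩ (noMove S r (r + 3))ᶜ) :=
      measure_mono (Set.inter_subset_inter_right _ fun ω hω hno =>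
        hno (r + 1) (by omega) (by omega) hω)
    calc P (pathEvent S (r + 1) h) ≤ 2 * P (pathEvent S (r + 1) h) := by
          rw [two_mul]; exact le_self_add
      _ ≤ 3 * P (pathEvent S (r + 1) h ∩ vertMove S (r + 1)) := h1
      _ ≤ 6 * P (pathEvent S (r + 1) h ∩ (noMove S r (r + 3))ᶜ) := by
          gcongr
          norm_num
  · push Not at hold
    set g : ℕ → Fin 4 → ℤ := Function.update h (r + 2) (h r) with hg
    have hgk : ∀ k, k ≤ r + 1 → g k = h k := fun k hk =>
      Function.update_of_ne (by omega) _ _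
    have hg2 : g (r + 2) = h r := Function.update_self _ _ _
    have hneg : ∀ d ∈ newSteps, (newSteps.filter fun e => e = -d).card = 1 := by decide
    have hpe : pathEvent S (r + 2) g
        = pathEvent S (r + 1) h ∩ {ω | step S (r + 1) ω = -(h (r + 1) - h r)} := by
      rw [pathEvent_inter_step]
      ext ω
      simp only [pathEvent, Set.mem_ofPred_eq]
      constructor
      · intro H
        refine ⟨fun k hk => (H k (by omega)).trans (hgk k hk), ?_⟩
        rw [H (r + 2) le_rfl, hg2]; abel
      · rintro ⟨H1, H2⟩ k hk
        rcases hk.lt_or_eq with hk | rfl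
        · rw [H1 k (by omega), hgk k (by omega)]
        · rw [hg2, H2]; abel
    have h1 := step_law_new hS (r + 1) h hold (fun e => e = -(h (r + 1) - h r))
    rw [hneg _ hd, ← hpe, Nat.cast_one, one_mul] at h1
    have h2 := two_mul_le_vertMove hS (r + 2) g ⟨r, by omega, by rw [hg2, hgk r (by omega)]⟩
    have h3 : P (pathEvent S (r + 2) g ∩ vertMove S (r + 2))
        ≤ P (pathEvent S (r + 1) h ∩ (noMove S r (r + 3))ᶜ) := by
      refine measure_mono (Set.inter_subset_inter ?_ fun ω hω hno =>
        hno (r + 2) (by omega) (by omega) hω)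
      rw [hpe]
      exact Set.inter_subset_left
    calc P (pathEvent S (r + 1) h) = P (pathEvent S (r + 2) g) * 4 := by
          rw [h1]; exact (ENNReal.div_mul_cancel (by norm_num) (by norm_num)).symm
      _ = 2 * (2 * P (pathEvent S (r + 2) g)) := by ring
      _ ≤ 2 * (3 * P (pathEvent S (r + 1) h ∩ (noMove S r (r + 3))ᶜ)) := by
          exact mul_le_mul_right (h2.trans (mul_le_mul_right h3 _)) _
      _ = 6 * P (pathEvent S (r + 1) h ∩ (noMove S r (r + 3))ᶜ) := by ring

/-- From any past, a vertical step occurs within three steps with probability at least `1/6`. -/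
lemma le_six_mul {r : ℕ} {E : Set Ω} (hE : DeterminedBy S r E) :
    P E ≤ 6 * P (E ∩ (noMove S r (r + 3))ᶜ) := by
  have key : ∀ g, 1 * P (pathEvent S r g ∩ Set.univ)
      ≤ 6 * P (pathEvent S r g ∩ (noMove S r (r + 3))ᶜ) := by
    intro g
    rw [one_mul, Set.inter_univ]
    by_cases hold : ∃ k < r, g r = g k
    · have h1 := two_mul_le_vertMove hS r g hold
      have h2 : P (pathEvent S r g ∩ vertMove S r)
          ≤ P (pathEvent S r g ∩ (noMove S r (r + 3))ᶜ) :=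
        measure_mono (Set.inter_subset_inter_right _ fun ω hω hno =>
          hno r le_rfl (by omega) hω)
      calc P (pathEvent S r g) ≤ 2 * P (pathEvent S r g) := by
            rw [two_mul]; exact le_self_add
        _ ≤ 3 * P (pathEvent S r g ∩ vertMove S r) := h1
        _ ≤ 6 * P (pathEvent S r g ∩ (noMove S r (r + 3))ᶜ) := by
            gcongr
            norm_num
    · push Not at hold
      have h1 := step_law_new hS r g hold (fun d => d ∈ newSteps)
      rw [show (newSteps.filter fun d => d ∈ newSteps).card = 4 by decide, Nat.cast_ofNat,
        ENNReal.mul_div_cancel (by norm_num) (by norm_num)] at h1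
      have hdet : DeterminedBy S (r + 1) (pathEvent S r g ∩ {ω | step S r ω ∈ newSteps}) :=
        ((determinedBy_pathEvent r g).mono (Nat.le_succ r)).inter
          (determinedBy_step (Nat.lt_succ_self r) fun d => d ∈ newSteps)
      have h2 := hdet.measure_le hS.1
        (μ := P.restrict {ω | step S r ω ∈ newSteps})
        (ν := (6 : ℝ≥0∞) • P.restrict (noMove S r (r + 3))ᶜ) fun g' => by
          rw [Measure.restrict_apply (measurableSet_pathEvent hS.1 _ _), Measure.smul_apply,
            Measure.restrict_apply (measurableSet_pathEvent hS.1 _ _), smul_eq_mul]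
          by_cases hd : g' (r + 1) - g' r ∈ newSteps
          · exact (measure_mono Set.inter_subset_left).trans (le_six_mul_of_step hS r g' hd)
          · have hempty : pathEvent S (r + 1) g' ∩ {ω | step S r ω ∈ newSteps} = ∅ := by
              refine Set.eq_empty_of_forall_notMem fun ω hω => hd ?_
              rw [← hω.1 (r + 1) le_rfl, ← hω.1 r (by omega)]
              exact hω.2
            rw [hempty, measure_empty]
            exact bot_le
      rw [Measure.restrict_apply (hdet.measurableSet hS.1), Measure.smul_apply,
        Measure.restrict_apply (hdet.measurableSet hS.1), smul_eq_mul, Set.inter_assoc,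
        Set.inter_self, h1] at h2
      refine h2.trans ?_
      gcongr
      exact Set.inter_subset_left
  simpa using hE.mul_measure_inter_le hS.1 key

omit [IsProbabilityMeasure P] in
lemma measurableSet_noMove (r s : ℕ) : MeasurableSet (noMove S r s) :=
  (determinedBy_noMove r s).measurableSet hS.1

lemma measure_noMove_three_le {r : ℕ} {E : Set Ω} (hE : DeterminedBy S r E) :
    P.real (E ∩ noMove S r (r + 3)) ≤ 5 / 6 * P.real E := by
  have h1 := ENNReal.toReal_mono (by finiteness) (le_six_mul hS hE)
  rw [ENNReal.toReal_mul] at h1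
  have h2 := measureReal_inter_add_sdiff (μ := P) (s := E) (measurableSet_noMove hS r (r + 3))
  rw [Set.sdiff_eq] at h2
  simp only [Measure.real] at h2 ⊢
  norm_num at h1
  linarith

lemma measure_noMove_le {r : ℕ} {E : Set Ω} (hE : DeterminedBy S r E) (j : ℕ) :
    P.real (E ∩ noMove S r (r + 3 * j)) ≤ (5 / 6) ^ j * P.real E := by
  induction j with
  | zero => simpa using measureReal_mono Set.inter_subset_left
  | succ j ih =>
    have h1 := measure_noMove_three_le hS
      ((hE.mono (Nat.le_add_right r (3 * j))).inter (determinedBy_noMove r (r + 3 * j)))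
    have h2 : E ∩ noMove S r (r + 3 * (j + 1))
        ⊆ E ∩ noMove S r (r + 3 * j) ∩ noMove S (r + 3 * j) (r + 3 * j + 3) :=
      fun ω hω => ⟨⟨hω.1, noMove_mono (by omega) hω.2⟩,
        fun k hk hk' => hω.2 k (by omega) (by omega)⟩
    calc _ ≤ _ := measureReal_mono h2
      _ ≤ _ := h1
      _ ≤ 5 / 6 * ((5 / 6) ^ j * P.real E) := by gcongr
      _ = _ := by ring

lemma ae_mem_goodSet : ∀ᵐ ω ∂P, ω ∈ goodSet S := by
  have h1 : ∀ᵐ ω ∂P, ∀ n, step S n ω ∈ newSteps ∪ oldSteps := by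
    refine ae_all_iff.2 fun n => ?_
    have := measure_step_eq hS (b := 1) (c := 1) (E := Set.univ) (n := n) (fun _ _ _ h => h)
      (fun d => d ∉ newSteps ∪ oldSteps) (fun _ => False)
      (by rw [show (newSteps.filter fun d => d ∉ newSteps ∪ oldSteps) = newSteps.filter
        fun _ => False by decide]) (by
        rw [show (oldSteps.filter fun d => d ∉ newSteps ∪ oldSteps) = oldSteps.filter
        fun _ => False by decide])
    rw [ae_iff]
    simpa using this
  have h2 : ∀ᵐ ω ∂P, ∀ n, ∃ m, n ≤ m ∧ ω ∈ vertMove S m := by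
    refine ae_all_iff.2 fun n => ?_
    rw [ae_iff]
    have hle : ∀ j : ℕ, P.real {ω | ¬∃ m, n ≤ m ∧ ω ∈ vertMove S m} ≤ (5 / 6) ^ j := fun j => by
      have h := measure_noMove_le hS (E := Set.univ) (r := n) (fun _ _ _ h => h) j
      rw [probReal_univ, mul_one, Set.univ_inter] at h
      refine (measureReal_mono fun ω hω => ?_).trans h
      exact fun k hk _ hv => hω ⟨k, hk, hv⟩
    have hlim := ge_of_tendsto' (tendsto_pow_atTop_nhds_zero_of_lt_one (r := (5 / 6 : ℝ))
      (by norm_num) (by norm_num)) hle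
    exact (measureReal_eq_zero_iff).1 (le_antisymm hlim measureReal_nonneg)
  filter_upwards [h1, h2] with ω h1 h2 using ⟨h1, h2⟩

end Confinement

section Measurability

variable {Ω : Type*} [MeasurableSpace Ω] {S : ℕ → Ω → Fin 4 → ℤ}

lemma measurable_sInf_nat {p : ℕ → Ω → Prop} (hp : ∀ n, MeasurableSet {ω | p n ω}) :
    Measurable fun ω => sInf {n : ℕ | p n ω} := by
  refine measurable_to_countable' fun m => ?_
  have : (fun ω => sInf {n : ℕ | p n ω}) ⁻¹' {m}
      = ({ω | p m ω} ∩ ⋂ k, ⋂ (_ : k < m), {ω | p k ω}ᶜ) ∪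
        ({ω | m = 0} ∩ ⋂ k, {ω | p k ω}ᶜ) := by
    ext ω
    simp only [Set.mem_preimage, Set.mem_singleton_iff, Set.mem_union, Set.mem_inter_iff,
      Set.mem_ofPred_eq, Set.mem_iInter, Set.mem_compl_iff]
    constructor
    · intro h
      by_cases hne : {n | p n ω}.Nonempty
      · exact Or.inl ⟨h ▸ Nat.sInf_mem hne, fun k hk => Nat.notMem_of_lt_sInf (h.symm ▸ hk)⟩
      · rw [Set.not_nonempty_iff_eq_empty] at hne
        rw [hne, Nat.sInf_empty] at h
        exact Or.inr ⟨h.symm, fun k hk => (hne ▸ (show k ∈ {n | p n ω} from hk) : k ∈ (∅ : Set ℕ))⟩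
    · rintro (⟨h1, h2⟩ | ⟨h1, h2⟩)
      · refine le_antisymm (Nat.sInf_le h1) ?_
        by_contra! hlt
        exact h2 _ hlt (Nat.sInf_mem (s := {n | p n ω}) ⟨m, h1⟩)
      · rw [h1, Nat.sInf_eq_zero]
        exact Or.inr (Set.eq_empty_of_forall_notMem h2)
  rw [this]
  exact ((hp m).inter
    (MeasurableSet.iInter fun k => MeasurableSet.iInter fun _ => (hp k).compl)).union
    ((MeasurableSet.const _).inter (MeasurableSet.iInter fun k => (hp k).compl))

lemma measurable_eval_nat {β : Type*} [MeasurableSpace β] {f : ℕ → Ω → β} {T : Ω → ℕ}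
    (hf : ∀ n, Measurable (f n)) (hT : Measurable T) : Measurable fun ω => f (T ω) ω :=
  (measurable_from_prod_countable_right (f := fun p : ℕ × Ω => f p.1 p.2) hf).comp
    (hT.prodMk measurable_id)

variable (hS : ∀ n, Measurable (S n))
include hS

lemma measurable_coord (n : ℕ) (i : Fin 4) : Measurable fun ω => S n ω i :=
  (measurable_pi_apply i).comp (hS n)

lemma measurable_tau (k : ℕ) : Measurable (tau S k) := by
  induction k with
  | zero => exact measurable_const
  | succ k ih =>
    refine measurable_sInf_nat fun n => ?_
    refine (measurableSet_lt ih measurable_const).inter (MeasurableSet.compl ?_)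
    exact (measurableSet_eq_fun (measurable_coord hS _ _) (measurable_coord hS _ _)).inter
      (measurableSet_eq_fun (measurable_coord hS _ _) (measurable_coord hS _ _))

lemma measurable_coord_tau (k : ℕ) (i : Fin 4) : Measurable fun ω => S (tau S k ω) ω i :=
  measurable_eval_nat (f := fun n ω => S n ω i) (fun n => measurable_coord hS n i)
    (measurable_tau hS k)

lemma measurable_Uproc (k : ℕ) : Measurable (Uproc S k) :=
  (measurable_coord_tau hS k 2).prodMk (measurable_coord_tau hS k 3)

lemma measurable_Uprocess : Measurable fun ω => fun k : ℕ => Uproc S k ω :=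
  measurable_pi_iff.2 (measurable_Uproc hS)

lemma measurable_MartMZ (k : ℕ) : Measurable (MartMZ S k) := measurable_coord_tau hS k 0

lemma measurable_MartM (k : ℕ) : Measurable (MartM S k) :=
  measurable_from_top.comp (measurable_MartMZ hS k)

lemma measurable_stopped (m : ℕ) :
    Measurable fun ω => (tau S m ω, fun k : ℕ => S (min k (tau S m ω)) ω) :=
  (measurable_tau hS m).prodMk (measurable_pi_iff.2 fun k =>
    measurable_eval_nat (f := fun n ω => S (min k n) ω) (fun _ => hS _) (measurable_tau hS m))

lemma stoppedSigma_sup_sigmaU_le (m : ℕ) :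
    stoppedSigma S m ⊔ sigmaU S ≤ ‹MeasurableSpace Ω› :=
  sup_le (measurable_stopped hS m).comap_le (measurable_Uprocess hS).comap_le

end Measurability

section Hull

variable {Ω : Type*} {S : ℕ → Ω → Fin 4 → ℤ}

/-- The trajectories which agree up to time `t` with one in `E`. -/
def pastHull (S : ℕ → Ω → Fin 4 → ℤ) (t : ℕ) (E : Set Ω) : Set Ω :=
  {ω | ∃ ω' ∈ E, ∀ k ≤ t, S k ω' = S k ω}

lemma determinedBy_pastHull (t : ℕ) (E : Set Ω) : DeterminedBy S t (pastHull S t E) := by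
  rintro ω ω' h ⟨ω'', h1, h2⟩
  exact ⟨ω'', h1, fun k hk => (h2 k hk).trans (h k hk)⟩

lemma subset_pastHull (t : ℕ) (E : Set Ω) : E ⊆ pastHull S t E :=
  fun ω hω => ⟨ω, hω, fun _ _ => rfl⟩

lemma tau_eq_of_mem_pastHull {n t : ℕ} {ω : Ω}
    (h : ω ∈ pastHull S t (goodSet S ∩ {ω | tau S n ω = t})) : tau S n ω = t := by
  obtain ⟨ω', ⟨h1, rfl⟩, h3⟩ := h
  exact tau_congr h1 n h3 n le_rfl

end Hull

section Integrability

variable {Ω : Type*} [MeasurableSpace Ω] {P : Measure Ω} [IsProbabilityMeasure P]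
  {S : ℕ → Ω → Fin 4 → ℤ} (hS : IsBERW 4 2 3 P S)
include hS

lemma measure_gap_le (n j : ℕ) :
    P {ω | tau S n ω + 3 * j < tau S (n + 1) ω} ≤ ENNReal.ofReal ((5 / 6) ^ j) := by
  set B : ℕ → Set Ω := fun t => pastHull S t (goodSet S ∩ {ω | tau S n ω = t}) with hB
  have hBdet : ∀ t, DeterminedBy S t (B t) := fun t => determinedBy_pastHull t _
  have hle : ∀ t, P (B t ∩ noMove S t (t + 3 * j)) ≤ ENNReal.ofReal ((5 / 6) ^ j) * P (B t) := by
    intro t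
    have h := ENNReal.ofReal_le_ofReal (measure_noMove_le hS (hBdet t) j)
    rwa [ENNReal.ofReal_mul (by positivity), ofReal_measureReal, ofReal_measureReal] at h
  have hsum : ∑' t, P (B t) ≤ 1 := by
    rw [← measure_univ (μ := P)]
    refine tsum_measure_le_measure_univ
      (fun t => ((hBdet t).measurableSet hS.1).nullMeasurableSet) fun t t' htt' =>
        (Set.disjoint_left.2 fun ω h h' => htt' ?_).aedisjoint
    rw [← tau_eq_of_mem_pastHull h, ← tau_eq_of_mem_pastHull h']
  calc P {ω | tau S n ω + 3 * j < tau S (n + 1) ω}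
      ≤ P (⋃ t, B t ∩ noMove S t (t + 3 * j)) := by
        refine measure_mono_ae ?_
        filter_upwards [ae_mem_goodSet hS] with ω hω hlt
        obtain ⟨s, h1, h2, h3, -⟩ := exists_tau_succ hω n
        change tau S n ω + 3 * j < tau S (n + 1) ω at hlt
        exact Set.mem_iUnion.2 ⟨tau S n ω, subset_pastHull _ _ ⟨hω, rfl⟩,
          noMove_mono (by omega) h3⟩
    _ ≤ ∑' t, P (B t ∩ noMove S t (t + 3 * j)) := measure_iUnion_le _
    _ ≤ ∑' t, ENNReal.ofReal ((5 / 6) ^ j) * P (B t) := ENNReal.tsum_le_tsum hle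
    _ = ENNReal.ofReal ((5 / 6) ^ j) * ∑' t, P (B t) := ENNReal.tsum_mul_left
    _ ≤ ENNReal.ofReal ((5 / 6) ^ j) := mul_le_of_le_one_right bot_le hsum

lemma integrable_gap_sq (n : ℕ) :
    Integrable (fun ω => ((tau S (n + 1) ω : ℝ) - tau S n ω) ^ 2) P := by
  have hmeas : ∀ k, Measurable fun ω => (tau S k ω : ℝ) := fun k =>
    measurable_from_top.comp (measurable_tau hS.1 k)
  refine ⟨((((hmeas _).sub (hmeas _))).pow_const 2).aestronglyMeasurable, ?_⟩
  set G : ℕ → Set Ω := fun j => {ω | tau S n ω + 3 * j < tau S (n + 1) ω} with hG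
  have hGm : ∀ j, MeasurableSet (G j) := fun j =>
    measurableSet_lt ((measurable_tau hS.1 n).add measurable_const) (measurable_tau hS.1 (n + 1))
  have hsummable : Summable fun j : ℕ => 9 * ((j : ℝ) + 1) ^ 2 * (5 / 6) ^ j := by
    have h := summable_pow_mul_geometric_of_norm_lt_one 2 (r := (5 / 6 : ℝ)) (by norm_num)
    have h' := ((summable_nat_add_iff 1).2 h).mul_left (9 * (6 / 5))
    refine h'.congr fun j => ?_
    push_cast
    rw [pow_succ]
    ring
  calc ∫⁻ ω, ‖((tau S (n + 1) ω : ℝ) - tau S n ω) ^ 2‖ₑ ∂P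
      ≤ ∫⁻ ω, ∑' j : ℕ, (G j).indicator (fun _ => ENNReal.ofReal (9 * ((j : ℝ) + 1) ^ 2)) ω ∂P := by
        refine lintegral_mono_ae ?_
        filter_upwards [ae_mem_goodSet hS] with ω hω
        obtain ⟨s, h1, h2, -⟩ := exists_tau_succ hω n
        set j := (s - tau S n ω) / 3 with hj
        refine le_trans ?_ (ENNReal.le_tsum j)
        have hmem : ω ∈ G j := show tau S n ω + 3 * j < tau S (n + 1) ω by omega
        rw [Set.indicator_of_mem hmem,
          Real.enorm_of_nonneg (by positivity)]
        refine ENNReal.ofReal_le_ofReal ?_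
        have h3 : tau S (n + 1) ω ≤ tau S n ω + 3 * (j + 1) := by omega
        have h4 : (tau S (n + 1) ω : ℝ) ≤ tau S n ω + 3 * (j + 1) := by exact_mod_cast h3
        have h5 : (tau S n ω : ℝ) ≤ tau S (n + 1) ω := by exact_mod_cast (by omega)
        nlinarith
    _ = ∑' j : ℕ, ENNReal.ofReal (9 * ((j : ℝ) + 1) ^ 2) * P (G j) := by
        rw [lintegral_tsum fun j => (measurable_const.indicator (hGm j)).aemeasurable]
        simp_rw [lintegral_indicator_const (hGm _)]
    _ ≤ ∑' j : ℕ, ENNReal.ofReal (9 * ((j : ℝ) + 1) ^ 2 * (5 / 6) ^ j) := by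
        refine ENNReal.tsum_le_tsum fun j => ?_
        rw [ENNReal.ofReal_mul (p := 9 * ((j : ℝ) + 1) ^ 2) (by positivity)]
        exact mul_le_mul_right (measure_gap_le hS n j) _
    _ < ∞ := hsummable.tsum_ofReal_lt_top

lemma integrable_gap (n : ℕ) :
    Integrable (fun ω => (tau S (n + 1) ω : ℝ) - tau S n ω) P := by
  have hmeas : ∀ k, Measurable fun ω => (tau S k ω : ℝ) := fun k =>
    measurable_from_top.comp (measurable_tau hS.1 k)
  exact ((memLp_two_iff_integrable_sq ((hmeas _).sub (hmeas _)).aestronglyMeasurable).2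
    (integrable_gap_sq hS n)).integrable (by norm_num)

omit [MeasurableSpace Ω] [IsProbabilityMeasure P] hS in
lemma abs_MartM_sub_le {ω : Ω} (hω : ω ∈ goodSet S) (n : ℕ) :
    |MartM S (n + 1) ω - MartM S n ω| ≤ (tau S (n + 1) ω : ℝ) - tau S n ω := by
  have hle := tau_mono hω n.le_succ
  have h := abs_sub_le hω (tau S n ω) (tau S (n + 1) ω - tau S n ω)
  rwa [Nat.add_sub_cancel' hle, Nat.cast_sub hle] at h

omit [IsProbabilityMeasure P] in
lemma measurable_increment (n : ℕ) :
    Measurable fun ω => MartM S (n + 1) ω - MartM S n ω :=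
  (measurable_MartM hS.1 _).sub (measurable_MartM hS.1 _)

lemma integrable_increment_sq (n : ℕ) :
    Integrable (fun ω => (MartM S (n + 1) ω - MartM S n ω) ^ 2) P := by
  refine (integrable_gap_sq hS n).mono'
    ((measurable_increment hS n).pow_const 2).aestronglyMeasurable ?_
  filter_upwards [ae_mem_goodSet hS] with ω hω
  rw [Real.norm_of_nonneg (sq_nonneg _), ← sq_abs]
  exact pow_le_pow_left₀ (abs_nonneg _) (abs_MartM_sub_le hω n) 2

lemma integrable_increment (n : ℕ) :
    Integrable (fun ω => MartM S (n + 1) ω - MartM S n ω) P := by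
  refine (integrable_gap hS n).mono' (measurable_increment hS n).aestronglyMeasurable ?_
  filter_upwards [ae_mem_goodSet hS] with ω hω
  exact abs_MartM_sub_le hω n

end Integrability

/-- Among the steps allowed from an old site, the proportion of the vertical ones whose
projection is `w`. -/
noncomputable def vertWeight (w : ℤ × ℤ) : ℝ≥0∞ :=
  (oldSteps.filter fun d => IsVert d ∧ (d 2, d 3) = w).card / 4

/-- On good trajectories, the event `E` depends only on the trajectory strictly before `τ_j`. -/
def KnownBefore {Ω : Type*} (S : ℕ → Ω → Fin 4 → ℤ) (j : ℕ) (E : Set Ω) : Prop :=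
  ∀ ω ∈ goodSet S, ∀ ω' ∈ goodSet S, ∀ s, tau S j ω = s + 1 → tau S j ω' = s + 1 →
    (∀ k ≤ s, S k ω = S k ω') → ω ∈ E → ω' ∈ E

section KnownBefore

variable {Ω : Type*} {S : ℕ → Ω → Fin 4 → ℤ}

lemma KnownBefore.inter {j : ℕ} {E F : Set Ω} (hE : KnownBefore S j E)
    (hF : KnownBefore S j F) : KnownBefore S j (E ∩ F) :=
  fun ω h1 ω' h2 s h3 h4 h5 h6 =>
    ⟨hE ω h1 ω' h2 s h3 h4 h5 h6.1, hF ω h1 ω' h2 s h3 h4 h5 h6.2⟩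

lemma KnownBefore.mono {n N : ℕ} (hnN : n ≤ N) {E : Set Ω} (hE : KnownBefore S (n + 1) E) :
    KnownBefore S (N + 1) E := by
  rcases hnN.eq_or_lt with rfl | hlt
  · exact hE
  intro ω h1 ω' h2 s h3 h4 h5 h6
  obtain ⟨s', h7, h8, -⟩ := exists_tau_succ h1 N
  obtain ⟨r, h9, -⟩ := exists_tau_succ h1 n
  have h10 : tau S (n + 1) ω ≤ tau S N ω := tau_mono h1 hlt
  have h11 := tau_congr h1 (n + 1) (fun k hk => h5 k (by omega)) (n + 1) le_rfl
  exact hE ω h1 ω' h2 r h9 (h11.trans h9) (fun k hk => h5 k (by omega)) h6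

lemma knownBefore_Uproc_prefix (N : ℕ) (u : ℕ → ℤ × ℤ) :
    KnownBefore S (N + 1) {ω | ∀ k ≤ N, Uproc S k ω = u k} := by
  intro ω h1 ω' h2 s h3 h4 h5 h6 k hk
  obtain ⟨s', h7, h8, -⟩ := exists_tau_succ h1 N
  have hle : tau S k ω ≤ tau S N ω := tau_mono h1 hk
  have h10 := tau_congr h1 N (fun i hi => h5 i (by omega)) k hk
  rw [← h6 k hk]
  simp only [Uproc, h10, h5 (tau S k ω) (by omega)]

/-- The event that the walk has the same history as `ω₀` up to time `τ_n`. -/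
def stoppedAtom (S : ℕ → Ω → Fin 4 → ℤ) (n : ℕ) (ω₀ : Ω) : Set Ω :=
  pathEvent S (tau S n ω₀) fun k => S k ω₀

lemma tau_eq_of_mem_stoppedAtom {ω₀ : Ω} (h₀ : ω₀ ∈ goodSet S) {n : ℕ} {ω : Ω}
    (h : ω ∈ stoppedAtom S n ω₀) : ∀ j ≤ n, tau S j ω = tau S j ω₀ :=
  tau_congr h₀ n fun k hk => (h k hk).symm

lemma Uproc_eq_of_mem_stoppedAtom {ω₀ : Ω} (h₀ : ω₀ ∈ goodSet S) {n : ℕ} {ω : Ω}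
    (h : ω ∈ stoppedAtom S n ω₀) : ∀ j ≤ n, Uproc S j ω = Uproc S j ω₀ := by
  intro j hj
  have hle : tau S j ω₀ ≤ tau S n ω₀ := tau_mono h₀ hj
  simp only [Uproc, tau_eq_of_mem_stoppedAtom h₀ h j hj, h (tau S j ω₀) hle]

lemma knownBefore_stoppedAtom {ω₀ : Ω} (h₀ : ω₀ ∈ goodSet S) (n : ℕ) :
    KnownBefore S (n + 1) (stoppedAtom S n ω₀) := by
  intro ω h1 ω' h2 s h3 h4 h5 h6 k hk
  obtain ⟨s', h7, h8, -⟩ := exists_tau_succ h1 n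
  have h10 := tau_eq_of_mem_stoppedAtom h₀ h6 n le_rfl
  rw [← h5 k (by omega), h6 k hk]

lemma knownBefore_increment (n : ℕ) (x : ℤ) :
    KnownBefore S (n + 1) {ω | MartMZ S (n + 1) ω - MartMZ S n ω = x} := by
  intro ω h1 ω' h2 s h3 h4 h5 h6
  have key : ∀ ω ∈ goodSet S, tau S (n + 1) ω = s + 1 →
      tau S n ω ≤ s ∧ MartMZ S (n + 1) ω = S s ω 0 := by
    intro ω hω hs
    obtain ⟨s', h7, h8, -, h9⟩ := exists_tau_succ hω n
    obtain rfl : s' = s := by omega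
    refine ⟨h8, ?_⟩
    have := step_zero_eq_zero hω h9
    simp only [step, Pi.sub_apply, sub_eq_zero] at this
    rw [MartMZ, hs, this]
  obtain ⟨h7, h8⟩ := key ω h1 h3
  have h9 := (key ω' h2 h4).2
  have h10 := tau_congr h1 n (fun i hi => h5 i (by omega)) n le_rfl
  change MartMZ S (n + 1) ω' - MartMZ S n ω' = x
  rw [← show MartMZ S (n + 1) ω - MartMZ S n ω = x from h6, h9, h8, h5 s le_rfl, MartMZ, MartMZ,
    h10, h5 _ h7]

end KnownBefore

section Independence

variable {Ω : Type*} [MeasurableSpace Ω] {P : Measure Ω} [IsProbabilityMeasure P]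
  {S : ℕ → Ω → Fin 4 → ℤ} (hS : IsBERW 4 2 3 P S)
include hS

lemma measure_vert_proj {s : ℕ} {E : Set Ω} (hE : DeterminedBy S s E) (w : ℤ × ℤ) :
    P (E ∩ {ω | IsVert (step S s ω) ∧ (step S s ω 2, step S s ω 3) = w})
      = vertWeight w * P (E ∩ {ω | IsVert (step S s ω)}) := by
  have h := measure_step_eq hS hE (b := 1) (c := vertWeight w)
    (fun d => IsVert d ∧ (d 2, d 3) = w) IsVert (by
      have h0 : ∀ d ∈ newSteps, ¬IsVert d := by decide
      rw [Finset.filter_false_of_mem h0, Finset.filter_false_of_mem fun d hd h => h0 d hd h.1]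
      simp) (by
      rw [show (oldSteps.filter IsVert).card = 4 by decide, vertWeight, one_mul, Nat.cast_ofNat]
      exact (ENNReal.div_mul_cancel (by norm_num) (by norm_num)).symm)
  rwa [one_mul] at h

omit hS [IsProbabilityMeasure P] in
lemma measure_eq_tsum_inter {T : Ω → ℕ} (hT : Measurable T) (h0 : ∀ᵐ ω ∂P, T ω ≠ 0) (G : Set Ω) :
    P G = ∑' s, P (G ∩ {ω | T ω = s + 1}) := by
  have h1 : ∀ s, MeasurableSet {ω | T ω = s + 1} := fun s => hT (measurableSet_singleton (s + 1))
  have h2 : P G = P.restrict G (⋃ s, {ω | T ω = s + 1}) := by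
    rw [← Measure.restrict_apply_univ]
    refine measure_congr ?_
    filter_upwards [ae_restrict_of_ae h0] with ω hω
    refine propext (iff_of_true trivial (Set.mem_iUnion.2 ⟨T ω - 1, ?_⟩))
    change T ω = T ω - 1 + 1
    omega
  rw [h2, measure_iUnion (fun s s' h => Set.disjoint_left.2 fun ω hω hω' => h ?_) h1]
  · simp_rw [Measure.restrict_apply (h1 _), Set.inter_comm]
  · have h3 : T ω = s + 1 := hω
    have h4 : T ω = s' + 1 := hω'
    omega

/-- The increment of `U` at `τ_{N+1}` is independent of what happens strictly before. -/
lemma measure_increment_Uproc {N : ℕ} {E : Set Ω} (hE : KnownBefore S (N + 1) E) (w : ℤ × ℤ) :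
    P (E ∩ {ω | Uproc S (N + 1) ω - Uproc S N ω = w}) = vertWeight w * P E := by
  have hT := measurable_tau hS.1 (N + 1)
  have h0 : ∀ᵐ ω ∂P, tau S (N + 1) ω ≠ 0 := by
    filter_upwards [ae_mem_goodSet hS] with ω hω
    obtain ⟨s, h, -⟩ := exists_tau_succ hω N
    omega
  rw [measure_eq_tsum_inter hT h0 E,
    measure_eq_tsum_inter hT h0 (E ∩ {ω | Uproc S (N + 1) ω - Uproc S N ω = w}),
    ← ENNReal.tsum_mul_left]
  congr 1
  funext s
  set F := pastHull S s (E ∩ goodSet S ∩ {ω | tau S (N + 1) ω = s + 1}) with hF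
  have hmem : ∀ ω ∈ goodSet S, (ω ∈ E ∧ tau S (N + 1) ω = s + 1) ↔
      ω ∈ F ∧ IsVert (step S s ω) := by
    intro ω hω
    constructor
    · rintro ⟨h1, h2⟩
      obtain ⟨s', h3, -, -, h4⟩ := exists_tau_succ hω N
      obtain rfl : s' = s := by omega
      exact ⟨subset_pastHull _ _ ⟨⟨h1, hω⟩, h2⟩, h4⟩
    · rintro ⟨⟨ω', ⟨⟨h1, h2⟩, h3⟩, h4⟩, h5⟩
      have h3 : tau S (N + 1) ω' = s + 1 := h3
      obtain ⟨s', h6, h7, h8, -⟩ := exists_tau_succ h2 N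
      obtain rfl : s' = s := by omega
      have h9 := tau_congr h2 N (fun k hk => h4 k (by omega)) N le_rfl
      have h10 : tau S (N + 1) ω = s' + 1 := by
        refine tau_succ_eq (by omega) ?_ h5
        rw [h9]
        exact determinedBy_noMove _ _ ω' ω h4 h8
      exact ⟨hE ω' h2 ω hω s' h3 h10 h4 h1, h10⟩
  have hproj : ∀ ω ∈ goodSet S, tau S (N + 1) ω = s + 1 →
      Uproc S (N + 1) ω - Uproc S N ω = (step S s ω 2, step S s ω 3) := by
    intro ω hω h1
    obtain ⟨s', h6, h7, h8, -⟩ := exists_tau_succ hω N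
    obtain rfl : s' = s := by omega
    have := vert_eq_of_noMove h8 h7 le_rfl
    rw [Uproc, Uproc, ← this, h1]
    rfl
  have h1 : P (E ∩ {ω | tau S (N + 1) ω = s + 1}) = P (F ∩ {ω | IsVert (step S s ω)}) := by
    refine measure_congr ?_
    filter_upwards [ae_mem_goodSet hS] with ω hω using propext (hmem ω hω)
  have h2 : P (E ∩ {ω | Uproc S (N + 1) ω - Uproc S N ω = w} ∩ {ω | tau S (N + 1) ω = s + 1})
      = P (F ∩ {ω | IsVert (step S s ω) ∧ (step S s ω 2, step S s ω 3) = w}) := by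
    refine measure_congr ?_
    filter_upwards [ae_mem_goodSet hS] with ω hω
    refine propext ?_
    change (ω ∈ E ∧ Uproc S (N + 1) ω - Uproc S N ω = w) ∧ tau S (N + 1) ω = s + 1 ↔
      ω ∈ F ∧ IsVert (step S s ω) ∧ (step S s ω 2, step S s ω 3) = w
    constructor
    · rintro ⟨⟨h1, h2⟩, h3⟩
      have := (hmem ω hω).1 ⟨h1, h3⟩
      exact ⟨this.1, this.2, by rw [← hproj ω hω h3, h2]⟩
    · rintro ⟨h1, h2, h3⟩
      have := (hmem ω hω).2 ⟨h1, h2⟩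
      exact ⟨⟨this.1, by rw [hproj ω hω this.2, h3]⟩, this.2⟩
  rw [h1, h2, measure_vert_proj hS (determinedBy_pastHull _ _) w]

/-- Given the history up to `τ_n`, an event known before `τ_{n+1}` is independent of the values of
`U` up to time `N`. -/
lemma measure_inter_Uproc_prefix {n : ℕ} {ω₀ : Ω} (h₀ : ω₀ ∈ goodSet S) {E : Set Ω}
    (hE : KnownBefore S (n + 1) E) (hEA : E ⊆ stoppedAtom S n ω₀) (u : ℕ → ℤ × ℤ) (N : ℕ) :
    P (stoppedAtom S n ω₀) * P (E ∩ {ω | ∀ k ≤ N, Uproc S k ω = u k})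
      = P E * P (stoppedAtom S n ω₀ ∩ {ω | ∀ k ≤ N, Uproc S k ω = u k}) := by
  set A := stoppedAtom S n ω₀ with hA
  have hle : ∀ N ≤ n, P A * P (E ∩ {ω | ∀ k ≤ N, Uproc S k ω = u k})
      = P E * P (A ∩ {ω | ∀ k ≤ N, Uproc S k ω = u k}) := by
    intro N hN
    by_cases hu : ∀ k ≤ N, Uproc S k ω₀ = u k
    · have hsub : A ⊆ {ω | ∀ k ≤ N, Uproc S k ω = u k} := fun ω hω k hk =>
        (Uproc_eq_of_mem_stoppedAtom h₀ hω k (hk.trans hN)).trans (hu k hk)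
      rw [Set.inter_eq_left.2 hsub, Set.inter_eq_left.2 (hEA.trans hsub), mul_comm]
    · have hemp : A ∩ {ω | ∀ k ≤ N, Uproc S k ω = u k} = ∅ :=
        Set.eq_empty_of_forall_notMem fun ω hω => hu fun k hk =>
          (Uproc_eq_of_mem_stoppedAtom h₀ hω.1 k (hk.trans hN)).symm.trans (hω.2 k hk)
      have hemp' : E ∩ {ω | ∀ k ≤ N, Uproc S k ω = u k} = ∅ :=
        Set.subset_eq_empty (Set.inter_subset_inter_left _ hEA) hemp
      rw [hemp, hemp', measure_empty, mul_zero, mul_zero]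
  have hsplit : ∀ (G : Set Ω) (N : ℕ), G ∩ {ω | ∀ k ≤ N + 1, Uproc S k ω = u k}
      = G ∩ {ω | ∀ k ≤ N, Uproc S k ω = u k} ∩
        {ω | Uproc S (N + 1) ω - Uproc S N ω = u (N + 1) - u N} := by
    intro G N
    ext ω
    simp only [Set.mem_inter_iff, Set.mem_ofPred_eq, and_assoc]
    refine and_congr_right fun _ => ⟨fun h => ⟨fun k hk => h k (by omega), ?_⟩, ?_⟩
    · rw [h _ le_rfl, h N (by omega)]
    · rintro ⟨h1, h2⟩ k hk
      rcases hk.lt_or_eq with hk | rfl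
      · exact h1 k (by omega)
      · rwa [h1 N le_rfl, sub_left_inj] at h2
  rcases le_total N n with hN | hN
  · exact hle N hN
  · induction N, hN using Nat.le_induction with
    | base => exact hle n le_rfl
    | succ N hN ih =>
      rw [hsplit, hsplit,
        measure_increment_Uproc hS ((hE.mono hN).inter (knownBefore_Uproc_prefix N u)),
        measure_increment_Uproc hS
          (((knownBefore_stoppedAtom h₀ n).mono hN).inter (knownBefore_Uproc_prefix N u)),
        mul_left_comm, ih, mul_left_comm]

end Independence

/-- Two finite measures on sequences in a countable space coincide when they agree on the sets of
sequences with a prescribed beginning. -/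
lemma measure_ext_of_prefix {α : Type*} [MeasurableSpace α] [Countable α]
    [MeasurableSingletonClass α] {μ ν : Measure (ℕ → α)} [IsFiniteMeasure μ] [IsFiniteMeasure ν]
    (h : ∀ (N : ℕ) (u : ℕ → α), μ {v | ∀ k ≤ N, v k = u k} = ν {v | ∀ k ≤ N, v k = u k}) :
    μ = ν := by
  have hν : IsProjectiveLimit ν fun I => ν.map I.restrict := fun I => rfl
  have hfam : IsProjectiveMeasureFamily (α := fun _ : ℕ => α) fun I => ν.map I.restrict := by
    intro I J hJI
    rw [Measure.map_map (Finset.measurable_restrict₂ _) (Finset.measurable_restrict _)]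
    rfl
  refine IsProjectiveLimit.unique ((isProjectiveLimit_nat_iff hfam μ).2 fun N => ?_) hν
  refine Measure.ext_of_singleton fun w => ?_
  rw [Measure.map_apply (Preorder.measurable_frestrictLe N) (measurableSet_singleton w),
    Measure.map_apply (Finset.measurable_restrict _) (measurableSet_singleton w)]
  have hw : ((Finset.Iic N).restrict : (ℕ → α) → _) ⁻¹' {w}
      = {v | ∀ k ≤ N, v k = w ⟨min k N, Finset.mem_Iic.2 (min_le_right _ _)⟩} := by
    ext v
    simp only [Set.mem_preimage, Set.mem_singleton_iff, funext_iff, Subtype.forall,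
      Finset.mem_Iic, Finset.restrict, Set.mem_ofPred_eq]
    refine forall₂_congr fun k hk => ?_
    simp only [min_eq_left hk]
  exact hw ▸ h N _

section AtomLaw

variable {Ω : Type*} [MeasurableSpace Ω] {P : Measure Ω} [IsProbabilityMeasure P]
  {S : ℕ → Ω → Fin 4 → ℤ} (hS : IsBERW 4 2 3 P S)
include hS

omit [IsProbabilityMeasure P] in
lemma measurableSet_stoppedAtom (n : ℕ) (ω₀ : Ω) : MeasurableSet (stoppedAtom S n ω₀) :=
  measurableSet_pathEvent hS.1 _ _

/-- Given the history up to `τ_n`, an event known before `τ_{n+1}` is independent of `U`. -/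
lemma measure_inter_Uprocess {n : ℕ} {ω₀ : Ω} (h₀ : ω₀ ∈ goodSet S) {E : Set Ω}
    (hE : KnownBefore S (n + 1) E) (hEA : E ⊆ stoppedAtom S n ω₀)
    {D : Set (ℕ → ℤ × ℤ)} (hD : MeasurableSet D) :
    P (stoppedAtom S n ω₀) * P (E ∩ {ω | (fun k => Uproc S k ω) ∈ D})
      = P E * P (stoppedAtom S n ω₀ ∩ {ω | (fun k => Uproc S k ω) ∈ D}) := by
  have hU := measurable_Uprocess hS.1
  have happ : ∀ (c : ℝ≥0∞) (G : Set Ω) {D : Set (ℕ → ℤ × ℤ)}, MeasurableSet D →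
      (c • (P.restrict G).map fun ω k => Uproc S k ω) D
        = c * P (G ∩ {ω | (fun k => Uproc S k ω) ∈ D}) := by
    intro c G D hD
    rw [Measure.smul_apply, Measure.map_apply hU hD, Measure.restrict_apply (hU hD),
      Set.inter_comm, smul_eq_mul]
    rfl
  have hpre : ∀ (N : ℕ) (u : ℕ → ℤ × ℤ),
      MeasurableSet {v : ℕ → ℤ × ℤ | ∀ k ≤ N, v k = u k} := by
    intro N u
    have : {v : ℕ → ℤ × ℤ | ∀ k ≤ N, v k = u k}
        = ⋂ k, ⋂ (_ : k ≤ N), (fun v : ℕ → ℤ × ℤ => v k) ⁻¹' {u k} := by ext; simp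
    rw [this]
    exact MeasurableSet.iInter fun k => MeasurableSet.iInter fun _ =>
      measurable_pi_apply k (measurableSet_singleton _)
  have hfin : ∀ (c : ℝ≥0∞) (G : Set Ω), c ≠ ∞ →
      IsFiniteMeasure (c • (P.restrict G).map fun ω k => Uproc S k ω) := fun c G hc =>
    Measure.smul_finite _ hc
  have := hfin _ E (measure_ne_top P (stoppedAtom S n ω₀))
  have := hfin _ (stoppedAtom S n ω₀) (measure_ne_top P E)
  have heq := measure_ext_of_prefix
    (μ := P (stoppedAtom S n ω₀) • (P.restrict E).map fun ω k => Uproc S k ω)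
    (ν := P E • (P.restrict (stoppedAtom S n ω₀)).map fun ω k => Uproc S k ω) fun N u => by
      rw [happ _ _ (hpre N u), happ _ _ (hpre N u)]
      exact measure_inter_Uproc_prefix hS h₀ hE hEA u N
  rw [← happ _ _ hD, heq, happ _ _ hD]

lemma integral_increment_inter_Uprocess {n : ℕ} {ω₀ : Ω} (h₀ : ω₀ ∈ goodSet S)
    {D : Set (ℕ → ℤ × ℤ)} (hD : MeasurableSet D) :
    P.real (stoppedAtom S n ω₀) *
        ∫ ω in stoppedAtom S n ω₀ ∩ {ω | (fun k => Uproc S k ω) ∈ D},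
          (MartM S (n + 1) ω - MartM S n ω) ^ 2 ∂P
      = P.real (stoppedAtom S n ω₀ ∩ {ω | (fun k => Uproc S k ω) ∈ D}) *
        ∫ ω in stoppedAtom S n ω₀, (MartM S (n + 1) ω - MartM S n ω) ^ 2 ∂P := by
  set A := stoppedAtom S n ω₀ with hA
  set B := A ∩ {ω | (fun k => Uproc S k ω) ∈ D} with hB
  have hZ : Measurable fun ω => MartMZ S (n + 1) ω - MartMZ S n ω :=
    (measurable_MartMZ hS.1 _).sub (measurable_MartMZ hS.1 _)
  have hint : ∀ G : Set Ω, ∫ ω in G, (MartM S (n + 1) ω - MartM S n ω) ^ 2 ∂P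
      = ∫ x, (x : ℝ) ^ 2 ∂(P.restrict G).map fun ω => MartMZ S (n + 1) ω - MartMZ S n ω := by
    intro G
    rw [integral_map hZ.aemeasurable
      (measurable_from_top (f := fun x : ℤ => (x : ℝ) ^ 2)).aestronglyMeasurable]
    simp only [MartM, MartMZ, Int.cast_sub]
  have heq : P A • (P.restrict B).map (fun ω => MartMZ S (n + 1) ω - MartMZ S n ω)
      = P B • (P.restrict A).map (fun ω => MartMZ S (n + 1) ω - MartMZ S n ω) := by
    refine Measure.ext_of_singleton fun x => ?_
    have hx := hZ (measurableSet_singleton x)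
    rw [Measure.smul_apply, Measure.smul_apply, Measure.map_apply hZ (measurableSet_singleton x),
      Measure.map_apply hZ (measurableSet_singleton x), Measure.restrict_apply hx,
      Measure.restrict_apply hx, smul_eq_mul, smul_eq_mul, mul_comm (P B)]
    have h := measure_inter_Uprocess hS h₀
      ((knownBefore_increment n x).inter (knownBefore_stoppedAtom h₀ n)) Set.inter_subset_right hD
    rw [Set.inter_assoc] at h
    exact h
  have h := congrArg (fun μ : Measure ℤ => ∫ x, (x : ℝ) ^ 2 ∂μ) heq
  simp only [integral_smul_measure, ← hint, smul_eq_mul] at h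
  exact h

end AtomLaw

section LowerBound

variable {Ω : Type*} [MeasurableSpace Ω] {P : Measure Ω} [IsProbabilityMeasure P]
  {S : ℕ → Ω → Fin 4 → ℤ} (hS : IsBERW 4 2 3 P S)
include hS

/-- The horizontal walk has centred steps. -/
lemma integral_step_zero {m : ℕ} {E : Set Ω} (hE : DeterminedBy S m E) :
    ∫ ω in E, (step S m ω 0 : ℝ) ∂P = 0 := by
  have hmeas : ∀ x : ℤ, MeasurableSet {ω | step S m ω 0 = x} := fun x =>
    measurableSet_step hS.1 m fun d => d 0 = x
  have heq : ∀ᵐ ω ∂P.restrict E, (step S m ω 0 : ℝ)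
      = {ω | step S m ω 0 = 1}.indicator (fun _ => (1 : ℝ)) ω
        - {ω | step S m ω 0 = -1}.indicator (fun _ => (1 : ℝ)) ω := by
    filter_upwards [ae_restrict_of_ae (ae_mem_goodSet hS)] with ω hω
    have key : ∀ d ∈ newSteps ∪ oldSteps, d 0 = 0 ∨ d 0 = 1 ∨ d 0 = -1 := by decide
    rcases key _ (hω.1 m) with h | h | h <;> simp [Set.indicator, h]
  have hlaw : P (E ∩ {ω | step S m ω 0 = 1}) = P (E ∩ {ω | step S m ω 0 = -1}) := by
    have h := measure_step_eq hS hE (b := 1) (c := 1) (fun d => d 0 = 1) (fun d => d 0 = -1)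
      (by rw [show (newSteps.filter fun d => d 0 = 1).card
        = (newSteps.filter fun d => d 0 = -1).card by decide])
      (by rw [show (oldSteps.filter fun d => d 0 = 1).card
        = (oldSteps.filter fun d => d 0 = -1).card by decide])
    rwa [one_mul, one_mul] at h
  have hI : ∀ x : ℤ, Integrable ({ω | step S m ω 0 = x}.indicator fun _ => (1 : ℝ))
      (P.restrict E) := fun x => (integrable_const 1).indicator (hmeas x)
  have hval : ∀ x : ℤ, ∫ ω in E, {ω | step S m ω 0 = x}.indicator (fun _ => (1 : ℝ)) ω ∂P
      = (P (E ∩ {ω | step S m ω 0 = x})).toReal := by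
    intro x
    rw [integral_indicator_const _ (hmeas x), smul_eq_mul, mul_one, measureReal_def,
      Measure.restrict_apply (hmeas x), Set.inter_comm]
  rw [integral_congr_ae heq, integral_sub (hI 1) (hI (-1)), hval, hval, hlaw, sub_self]

/-- Optional stopping between a fixed time `r` and `τ_{n+1}`. -/
lemma integral_MartM_sub_eq_zero {n r : ℕ} {F : Set Ω} (hF : DeterminedBy S r F)
    (h : ∀ ω ∈ F ∩ goodSet S, tau S n ω ≤ r ∧ r < tau S (n + 1) ω) :
    ∫ ω in F, (MartM S (n + 1) ω - (S r ω 0 : ℤ)) ∂P = 0 := by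
  have hgood := ae_mem_goodSet hS
  have hFm := hF.measurableSet hS.1
  set g : ℕ → Ω → ℝ := fun K ω => (S (min (r + K) (tau S (n + 1) ω)) ω 0 : ℤ) - (S r ω 0 : ℤ)
    with hg
  have hcast : ∀ {f : Ω → ℤ}, Measurable f → Measurable fun ω => (f ω : ℝ) := fun hf =>
    (measurable_from_top (f := fun x : ℤ => (x : ℝ))).comp hf
  have hgm : ∀ K, Measurable (g K) := fun K =>
    (hcast (measurable_eval_nat (f := fun s ω => S (min (r + K) s) ω 0)
      (fun s => measurable_coord hS.1 _ 0) (measurable_tau hS.1 (n + 1)))).sub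
      (hcast (measurable_coord hS.1 r 0))
  have hbound : ∀ K, ∀ᵐ ω ∂P.restrict F,
      ‖g K ω‖ ≤ (tau S (n + 1) ω : ℝ) - tau S n ω := by
    intro K
    filter_upwards [ae_restrict_of_ae hgood, ae_restrict_mem hFm] with ω hω hωF
    obtain ⟨h1, h2⟩ := h ω ⟨hωF, hω⟩
    have h3 := abs_sub_le hω r (min (r + K) (tau S (n + 1) ω) - r)
    rw [Nat.add_sub_cancel' (by omega)] at h3
    refine h3.trans ?_
    rw [← Nat.cast_sub (by omega)]
    exact_mod_cast (by omega)
  have hgap := (integrable_gap hS n).restrict (s := F)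
  have hgi : ∀ K, Integrable (g K) (P.restrict F) := fun K =>
    hgap.mono' (hgm K).aestronglyMeasurable (hbound K)
  have hzero : ∀ K, ∫ ω in F, g K ω ∂P = 0 := by
    intro K
    induction K with
    | zero =>
      refine integral_eq_zero_of_ae ?_
      filter_upwards [ae_restrict_of_ae hgood, ae_restrict_mem hFm] with ω hω hωF
      have h2 := (h ω ⟨hωF, hω⟩).2
      simp [hg, min_eq_left h2.le]
    | succ K ih =>
      have hNm := measurableSet_noMove hS r (r + K)
      have heq : ∀ᵐ ω ∂P.restrict F, g (K + 1) ω
          = g K ω + (noMove S r (r + K)).indicator (fun ω => (step S (r + K) ω 0 : ℝ)) ω := by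
        filter_upwards [ae_restrict_of_ae hgood, ae_restrict_mem hFm] with ω hω hωF
        obtain ⟨h1, h2⟩ := h ω ⟨hωF, hω⟩
        obtain ⟨s, h3, h4, h5, h6⟩ := exists_tau_succ hω n
        by_cases hs : r + K ≤ s
        · have hmem : ω ∈ noMove S r (r + K) := fun k hk hk' => h5 k (by omega) (by omega)
          rw [Set.indicator_of_mem hmem]
          simp only [hg, h3, min_eq_left (show r + K ≤ s + 1 by omega),
            min_eq_left (show r + K + 1 ≤ s + 1 by omega), step, Pi.sub_apply, ← add_assoc]
          push_cast
          ring
        · have hmem : ω ∉ noMove S r (r + K) := fun hm => hm s (by omega) (by omega) h6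
          rw [Set.indicator_of_notMem hmem]
          simp only [hg, h3, min_eq_right (show s + 1 ≤ r + K by omega),
            min_eq_right (show s + 1 ≤ r + (K + 1) by omega), add_zero]
      have hi : Integrable ((noMove S r (r + K)).indicator fun ω => (step S (r + K) ω 0 : ℝ))
          (P.restrict F) := by
        refine Integrable.indicator ?_ hNm
        refine (integrable_const (1 : ℝ)).mono' (hcast
          ((measurable_pi_apply 0).comp (measurable_step hS.1 _))).aestronglyMeasurable ?_
        filter_upwards [ae_restrict_of_ae hgood] with ω hω using abs_step_zero_le hω _
      rw [integral_congr_ae heq, integral_add (hgi K) hi, ih, zero_add, setIntegral_indicator hNm]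
      exact integral_step_zero hS ((hF.mono (by omega)).inter (determinedBy_noMove r (r + K)))
  refine tendsto_nhds_unique (tendsto_integral_of_dominated_convergence _
    (fun K => (hgm K).aestronglyMeasurable) hgap hbound ?_)
    (by simp only [hzero]; exact tendsto_const_nhds)
  refine Eventually.of_forall fun ω => ?_
  refine tendsto_const_nhds.congr' ?_
  filter_upwards [eventually_ge_atTop (tau S (n + 1) ω)] with K hK
  simp only [hg, MartM, min_eq_right (show tau S (n + 1) ω ≤ r + K by omega)]

/-- Given a history up to `τ_n` at which `U_n` is a new site, the conditional second moment of the
increment of `M` is at least `1/2`. -/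
lemma half_le_integral_increment_sq {n : ℕ} {ω₀ : Ω} (h₀ : ω₀ ∈ goodSet S)
    (hnew : ∀ k < n, Uproc S n ω₀ ≠ Uproc S k ω₀) :
    1 / 2 * P.real (stoppedAtom S n ω₀)
      ≤ ∫ ω in stoppedAtom S n ω₀, (MartM S (n + 1) ω - MartM S n ω) ^ 2 ∂P := by
  set A := stoppedAtom S n ω₀ with hA
  set t := tau S n ω₀ with ht
  have hAm : MeasurableSet A := measurableSet_stoppedAtom hS n ω₀
  have hAdet : DeterminedBy S t A := determinedBy_pathEvent _ _
  have hf := integrable_increment_sq hS n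
  set F : ℤ → Set Ω := fun e => A ∩ {ω | step S t ω 0 = e} with hF
  have hFdet : ∀ e, DeterminedBy S (t + 1) (F e) := fun e =>
    (hAdet.mono t.le_succ).inter (determinedBy_step t.lt_succ_self fun d => d 0 = e)
  have hFm : ∀ e, MeasurableSet (F e) := fun e => (hFdet e).measurableSet hS.1
  have hlaw : ∀ e : ℤ, e = 1 ∨ e = -1 → P.real (F e) = P.real A / 4 := by
    intro e he
    have h := step_law_new hS t (fun k => S k ω₀) (site_new_of_Uproc_new h₀ hnew) fun d => d 0 = e
    have hc : (newSteps.filter fun d => d 0 = e).card = 1 := by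
      rcases he with rfl | rfl <;> decide
    rw [hc, Nat.cast_one, one_mul] at h
    rw [measureReal_def, show P (F e) = P A / 4 from h, ENNReal.toReal_div]
    rfl
  have hlow : ∀ e : ℤ, e = 1 ∨ e = -1 →
      P.real (F e) ≤ ∫ ω in F e, (MartM S (n + 1) ω - MartM S n ω) ^ 2 ∂P := by
    intro e he
    have hzero : ∫ ω in F e, (MartM S (n + 1) ω - (S (t + 1) ω 0 : ℤ)) ∂P = 0 := by
      refine integral_MartM_sub_eq_zero hS (hFdet e) fun ω hω => ?_
      have hτ : tau S n ω = t := tau_eq_of_mem_stoppedAtom h₀ hω.1.1 n le_rfl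
      obtain ⟨s, h3, h4, h5, h6⟩ := exists_tau_succ hω.2 n
      refine ⟨by omega, ?_⟩
      rcases eq_or_ne s t with rfl | hne
      · have h7 := step_zero_eq_zero hω.2 h6
        have h8 : step S t ω 0 = e := hω.1.2
        omega
      · omega
    have hM : ∀ ω ∈ F e, MartM S (n + 1) ω - (S (t + 1) ω 0 : ℤ)
        = MartM S (n + 1) ω - MartM S n ω - e := by
      intro ω hω
      have hτ : tau S n ω = t := tau_eq_of_mem_stoppedAtom h₀ hω.1 n le_rfl
      have h8 : S (t + 1) ω 0 - S t ω 0 = e := hω.2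
      simp only [MartM, hτ, ← h8]
      push_cast
      ring
    have hi := (integrable_increment hS n).restrict (s := F e)
    rw [setIntegral_congr_fun (hFm e) hM, integral_sub hi (integrable_const _),
      setIntegral_const, smul_eq_mul, sub_eq_zero] at hzero
    have he2 : (e : ℝ) * e = 1 := by rcases he with rfl | rfl <;> norm_num
    calc P.real (F e)
        = ∫ ω in F e, (2 * (e : ℝ) * (MartM S (n + 1) ω - MartM S n ω) - 1) ∂P := by
          rw [integral_sub (hi.const_mul _) (integrable_const _), integral_const_mul, hzero,
            setIntegral_const, smul_eq_mul]
          linear_combination (-2 * P.real (F e)) * he2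
      _ ≤ _ := by
          refine integral_mono ((hi.const_mul _).sub (integrable_const _)) hf.restrict fun ω => ?_
          change 2 * (e : ℝ) * (MartM S (n + 1) ω - MartM S n ω) - 1
            ≤ (MartM S (n + 1) ω - MartM S n ω) ^ 2
          nlinarith [sq_nonneg (MartM S (n + 1) ω - MartM S n ω - e)]
  have hdisj : Disjoint (F 1) (F (-1)) := Set.disjoint_left.2 fun ω h1 h2 => by
    have h3 : step S t ω 0 = 1 := h1.2
    have h4 : step S t ω 0 = -1 := h2.2
    omega
  calc 1 / 2 * P.real A = P.real (F 1) + P.real (F (-1)) := by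
        rw [hlaw 1 (Or.inl rfl), hlaw (-1) (Or.inr rfl)]; ring
    _ ≤ ∫ ω in F 1 ∪ F (-1), (MartM S (n + 1) ω - MartM S n ω) ^ 2 ∂P := by
        rw [setIntegral_union hdisj (hFm _) hf.integrableOn hf.integrableOn]
        exact add_le_add (hlow 1 (Or.inl rfl)) (hlow (-1) (Or.inr rfl))
    _ ≤ _ := setIntegral_mono_set hf.integrableOn (Eventually.of_forall fun _ => sq_nonneg _)
        (Set.union_subset Set.inter_subset_left Set.inter_subset_left).eventuallyLE

end LowerBound

section ConditionalBound

variable {Ω : Type*} [MeasurableSpace Ω] {P : Measure Ω} [IsProbabilityMeasure P]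
  {S : ℕ → Ω → Fin 4 → ℤ} (hS : IsBERW 4 2 3 P S)
include hS

omit [MeasurableSpace Ω] [IsProbabilityMeasure P] hS in
lemma stoppedAtom_eq_preimage {n : ℕ} {ω₀ : Ω} (h₀ : ω₀ ∈ goodSet S) :
    stoppedAtom S n ω₀ = (fun ω => (tau S n ω, fun k : ℕ => S (min k (tau S n ω)) ω)) ⁻¹'
      {(tau S n ω₀, fun k : ℕ => S (min k (tau S n ω₀)) ω₀)} := by
  ext ω
  simp only [Set.mem_preimage, Set.mem_singleton_iff, Prod.mk.injEq]
  constructor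
  · intro hω
    have hτ := tau_eq_of_mem_stoppedAtom h₀ hω n le_rfl
    refine ⟨hτ, funext fun k => ?_⟩
    rw [hτ]
    exact hω _ (min_le_right _ _)
  · rintro ⟨hτ, h⟩ k hk
    have := congrFun h k
    rwa [hτ, min_eq_left hk] at this

omit [IsProbabilityMeasure P] hS in
lemma exists_preimage_of_measurableSet {n : ℕ} {N : Set Ω}
    (hN : MeasurableSet[stoppedSigma S n ⊔ sigmaU S] N) :
    ∃ T : Set ((ℕ × (ℕ → Fin 4 → ℤ)) × (ℕ → ℤ × ℤ)), MeasurableSet T ∧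
      N = (fun ω => ((tau S n ω, fun k : ℕ => S (min k (tau S n ω)) ω),
        fun k => Uproc S k ω)) ⁻¹' T := by
  rw [stoppedSigma, sigmaU, ← MeasurableSpace.comap_prodMk] at hN
  obtain ⟨T, hT, rfl⟩ := hN
  exact ⟨T, hT, rfl⟩

/-- On a history up to `τ_n` at which `U_n` is new, the conditional second moment of the increment
of `M` is almost surely at least `1/2`. -/
lemma measure_inter_stoppedAtom_eq_zero {n : ℕ} {ω₀ : Ω} (h₀ : ω₀ ∈ goodSet S)
    (hnew : ∀ k < n, Uproc S n ω₀ ≠ Uproc S k ω₀) {N : Set Ω}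
    (hN : MeasurableSet[stoppedSigma S n ⊔ sigmaU S] N)
    (hlt : ∀ ω ∈ N, (P[(fun ω' => (MartM S (n + 1) ω' - MartM S n ω') ^ 2)|
      stoppedSigma S n ⊔ sigmaU S]) ω < 1 / 2) :
    P (N ∩ stoppedAtom S n ω₀) = 0 := by
  set A := stoppedAtom S n ω₀ with hA
  have hm := stoppedSigma_sup_sigmaU_le hS.1 n
  have hAm : MeasurableSet[stoppedSigma S n ⊔ sigmaU S] A := by
    have h : MeasurableSet[stoppedSigma S n] A := by
      rw [hA, stoppedAtom_eq_preimage h₀]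
      exact ⟨_, measurableSet_singleton _, rfl⟩
    exact (le_sup_left : stoppedSigma S n ≤ stoppedSigma S n ⊔ sigmaU S) _ h
  obtain ⟨T, hT, hNT⟩ := exists_preimage_of_measurableSet hN
  set D : Set (ℕ → ℤ × ℤ) :=
    Prod.mk (tau S n ω₀, fun k : ℕ => S (min k (tau S n ω₀)) ω₀) ⁻¹' T with hD
  have hDm : MeasurableSet D := measurable_prodMk_left hT
  have hB : N ∩ A = A ∩ {ω | (fun k => Uproc S k ω) ∈ D} := by
    rw [Set.inter_comm]
    ext ω
    refine and_congr_right fun hω => ?_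
    rw [hA, stoppedAtom_eq_preimage h₀] at hω
    rw [hNT, hD]
    simp only [Set.mem_preimage, Set.mem_singleton_iff] at hω ⊢
    rw [hω]
    rfl
  have hBm : MeasurableSet[stoppedSigma S n ⊔ sigmaU S] (N ∩ A) := hN.inter hAm
  have hf := integrable_increment_sq hS n
  have hint := integral_increment_inter_Uprocess hS (n := n) h₀ hDm
  rw [← hB, ← setIntegral_condExp hm hf hBm] at hint
  set g := P[(fun ω' => (MartM S (n + 1) ω' - MartM S n ω') ^ 2)|stoppedSigma S n ⊔ sigmaU S]
    with hg
  have hgi : Integrable g P := integrable_condExp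
  by_contra hne
  have hApos : 0 < P.real A := by
    refine (measureReal_nonneg).lt_of_ne fun h => hne ?_
    exact measure_mono_null Set.inter_subset_right ((measureReal_eq_zero_iff).1 h.symm)
  have hlow : 1 / 2 * P.real (N ∩ A) ≤ ∫ ω in N ∩ A, g ω ∂P := by
    have h := mul_le_mul_of_nonneg_left (half_le_integral_increment_sq hS h₀ hnew)
      (measureReal_nonneg (μ := P) (s := N ∩ A))
    rw [← hint] at h
    refine le_of_mul_le_mul_left ?_ hApos
    linarith
  have hi : IntegrableOn (fun ω => 1 / 2 - g ω) (N ∩ A) P :=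
    ((integrable_const _).sub hgi).integrableOn
  have hpos : 0 < ∫ ω in N ∩ A, (1 / 2 - g ω) ∂P := by
    rw [setIntegral_pos_iff_support_of_nonneg_ae _ hi]
    · refine (pos_iff_ne_zero.2 hne).trans_le (measure_mono fun ω hω => ⟨?_, hω⟩)
      exact (sub_pos.2 (hlt ω hω.1)).ne'
    · filter_upwards [ae_restrict_mem (hm _ hBm)] with ω hω
      exact (sub_pos.2 (hlt ω hω.1)).le
  rw [integral_sub (integrable_const _) hgi.integrableOn, setIntegral_const, smul_eq_mul] at hpos
  linarith

theorem half_le_condExp_increment_sq (n : ℕ) :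
    ∀ᵐ ω ∂P, (∀ k < n, Uproc S n ω ≠ Uproc S k ω) →
      (1 : ℝ) / 2 ≤ (P[(fun ω' => (MartM S (n + 1) ω' - MartM S n ω') ^ 2)|
          stoppedSigma S n ⊔ sigmaU S]) ω := by
  set g := P[(fun ω' => (MartM S (n + 1) ω' - MartM S n ω') ^ 2)|stoppedSigma S n ⊔ sigmaU S]
    with hg
  set N : Set Ω := {ω | ∀ k < n, Uproc S n ω ≠ Uproc S k ω} ∩ {ω | g ω < 1 / 2} with hN
  have hNm : MeasurableSet[stoppedSigma S n ⊔ sigmaU S] N := by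
    have hD : MeasurableSet {v : ℕ → ℤ × ℤ | ∀ k < n, v n ≠ v k} := by
      simp only [Set.ofPred_forall]
      exact MeasurableSet.iInter fun k => MeasurableSet.iInter fun _ =>
        (measurableSet_eq_fun (measurable_pi_apply n) (measurable_pi_apply k)).compl
    have hU : MeasurableSet[sigmaU S] {ω | ∀ k < n, Uproc S n ω ≠ Uproc S k ω} := ⟨_, hD, rfl⟩
    exact MeasurableSet.inter
      ((le_sup_right : sigmaU S ≤ stoppedSigma S n ⊔ sigmaU S) _ hU)
      (measurableSet_lt stronglyMeasurable_condExp.measurable measurable_const)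
  set C : (Σ t : ℕ, Fin (t + 1) → Fin 4 → ℤ) → Set Ω := fun c =>
    {ω | tau S n ω = c.1 ∧ ∀ i : Fin (c.1 + 1), S i ω = c.2 i} with hC
  have hnull : ∀ c, P (N ∩ goodSet S ∩ C c) = 0 := by
    intro c
    rcases (N ∩ goodSet S ∩ C c).eq_empty_or_nonempty with hemp | ⟨ω₀, ⟨h1, h0⟩, h2, h3⟩
    · rw [hemp, measure_empty]
    · refine measure_mono_null ?_
        (measure_inter_stoppedAtom_eq_zero hS h0 h1.1 hNm fun ω hω => hω.2)
      rintro ω ⟨⟨h4, -⟩, h5, h6⟩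
      refine ⟨h4, fun k hk => ?_⟩
      exact (h6 ⟨k, by omega⟩).trans (h3 ⟨k, by omega⟩).symm
  have hall : P (⋃ c, N ∩ goodSet S ∩ C c) = 0 := measure_iUnion_null hnull
  filter_upwards [ae_mem_goodSet hS, measure_eq_zero_iff_ae_notMem.1 hall] with ω hω hω' hnew
  by_contra! hlt
  exact hω' (Set.mem_iUnion.2 ⟨⟨tau S n ω, fun i => S i ω⟩, ⟨⟨hnew, hlt⟩, hω⟩, rfl, fun _ => rfl⟩)

end ConditionalBound

section Range

variable {Ω : Type*} {S : ℕ → Ω → Fin 4 → ℤ}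

lemma rangeCardU_succ_le (m : ℕ) (ω : Ω) :
    (rangeCardU S (m + 1) ω : ℝ)
      ≤ rangeCardU S m ω + if ∀ k < m + 1, Uproc S (m + 1) ω ≠ Uproc S k ω then 1 else 0 := by
  rw [rangeCardU, Finset.range_add_one, Finset.image_insert]
  split_ifs with h
  · exact_mod_cast Finset.card_insert_le _ _
  · push Not at h
    obtain ⟨k, hk, hk'⟩ := h
    rw [Finset.insert_eq_of_mem (Finset.mem_image.2 ⟨k, Finset.mem_range.2 hk, hk'.symm⟩),
      add_zero]
    rfl

lemma rangeCardU_sub_le {a b : ℕ} (hab : a ≤ b) (ω : Ω) :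
    (rangeCardU S b ω : ℝ) - rangeCardU S a ω - 1
      ≤ ∑ m ∈ Finset.Ico a b, if ∀ k < m, Uproc S m ω ≠ Uproc S k ω then (1 : ℝ) else 0 := by
  set c : ℕ → ℝ := fun m => if ∀ k < m, Uproc S m ω ≠ Uproc S k ω then 1 else 0 with hc
  have h0 : ∀ m, 0 ≤ c m := fun m => by simp only [hc]; split_ifs <;> norm_num
  have h1 : ∀ m, c m ≤ 1 := fun m => by simp only [hc]; split_ifs <;> norm_num
  suffices H : (rangeCardU S b ω : ℝ) - c b - (rangeCardU S a ω - c a)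
      ≤ ∑ m ∈ Finset.Ico a b, c m by linarith [h0 a, h1 b]
  induction b, hab using Nat.le_induction with
  | base => simp
  | succ b hb ih =>
    rw [Finset.sum_Ico_succ_top hb]
    have : (rangeCardU S (b + 1) ω : ℝ) ≤ rangeCardU S b ω + c (b + 1) := rangeCardU_succ_le b ω
    linarith

lemma timeIdx_le_succ (n k : ℕ) : timeIdx n k ≤ timeIdx n (k + 1) :=
  Nat.sub_le_sub_left (Nat.div_le_div_left (Nat.pow_le_pow_right two_pos k.le_succ)
    (Nat.two_pow_pos k)) n

lemma le_timeIdx_succ_sub (n k : ℕ) :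
    (n : ℝ) / 2 ^ k / 2 - 1 / 2 ≤ (timeIdx n (k + 1) : ℝ) - timeIdx n k := by
  have h1 : n / 2 ^ (k + 1) = n / 2 ^ k / 2 := by rw [pow_succ, Nat.div_div_eq_div_mul]
  have h2 : n / 2 ^ k ≤ n := Nat.div_le_self _ _
  have h3 : n / 2 ^ k ≤ 2 * (timeIdx n (k + 1) - timeIdx n k) := by
    rw [timeIdx, timeIdx, h1]
    omega
  have h4 : ((n / 2 ^ k : ℕ) : ℝ) ≤ 2 * ((timeIdx n (k + 1) : ℝ) - timeIdx n k) := by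
    rw [← Nat.cast_sub (timeIdx_le_succ n k)]
    exact_mod_cast h3
  have h5 : (n : ℝ) < 2 ^ k * ((n / 2 ^ k : ℕ) + 1) := by
    exact_mod_cast Nat.lt_mul_div_succ n (Nat.two_pow_pos k)
  have h6 : (n : ℝ) / 2 ^ k < (n / 2 ^ k : ℕ) + 1 := by
    rw [div_lt_iff₀ (by positivity)]
    linarith
  linarith

lemma two_pow_le_exp_half_log {L : ℝ} (hL : 16 ≤ L) {k : ℕ} (hk : k ≤ ⌊L ^ ((3 : ℝ) / 4)⌋₊) :
    (2 : ℝ) ^ k ≤ Real.exp (L / 2) := by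
  have h1 : (2 : ℝ) ≤ L ^ ((1 : ℝ) / 4) := by
    rw [one_div, Real.le_rpow_inv_iff_of_pos (by norm_num) (by linarith) (by norm_num)]
    norm_num
    exact hL
  have h2 : L ^ ((3 : ℝ) / 4) * L ^ ((1 : ℝ) / 4) = L := by
    rw [← Real.rpow_add (by linarith)]
    norm_num
  have h3 : (k : ℝ) ≤ L / 2 := by
    have h4 : (k : ℝ) ≤ L ^ ((3 : ℝ) / 4) := (Nat.le_floor_iff (by positivity)).1 hk
    have h5 : (0 : ℝ) ≤ L ^ ((3 : ℝ) / 4) := by positivity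
    nlinarith
  calc (2 : ℝ) ^ k ≤ Real.exp 1 ^ k :=
        pow_le_pow_left₀ (by norm_num) (by linarith [Real.add_one_le_exp 1]) k
    _ = Real.exp k := Real.exp_one_pow k
    _ ≤ Real.exp (L / 2) := Real.exp_le_exp.2 h3

lemma two_le_of_mem_goodScalesU {ρ₀ : ℝ} (hρ₀ : 0 < ρ₀) {n : ℕ} (h16 : 16 ≤ Real.log n)
    (hρ : 32 / ρ₀ ≤ Real.log n) {k : ℕ} (hk : k ≤ ⌊(Real.log n) ^ ((3 : ℝ) / 4)⌋₊) :
    2 ≤ ρ₀ * ((timeIdx n (k + 1) : ℝ) - timeIdx n k) / Real.log n := by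
  set L := Real.log n with hL
  have hn : (n : ℝ) = Real.exp (L / 2) * Real.exp (L / 2) := by
    have hpos : (0 : ℝ) < n := by
      rcases Nat.eq_zero_or_pos n with rfl | h
      · norm_num [hL] at h16
      · exact_mod_cast h
    rw [← Real.exp_add, add_halves, Real.exp_log hpos]
  have h1 : Real.exp (L / 2) ≤ n / 2 ^ k := by
    rw [le_div_iff₀ (by positivity), hn]
    exact mul_le_mul_of_nonneg_left (two_pow_le_exp_half_log h16 hk) (Real.exp_pos _).le
  have h2 := Real.quadratic_le_exp_of_nonneg (x := L / 2) (by linarith)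
  have h3 := le_timeIdx_succ_sub n k
  rw [div_le_iff₀ hρ₀] at hρ
  rw [le_div_iff₀ (by linarith)]
  have h4 : L ^ 2 / 16 ≤ (timeIdx n (k + 1) : ℝ) - timeIdx n k := by nlinarith
  calc 2 * L ≤ ρ₀ * (L ^ 2 / 16) := by nlinarith
    _ ≤ _ := mul_le_mul_of_nonneg_left h4 hρ₀.le

end Range

/-- Deterministic comparison of the quadratic variation with the range of `U`. -/
lemma range_le_quadVarU {Ω : Type*} [MeasurableSpace Ω] {P : Measure Ω}
    {S : ℕ → Ω → Fin 4 → ℤ} {ω : Ω}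
    (h0 : ∀ m, 0 ≤ (P[(fun ω' => (MartM S (m + 1) ω' - MartM S m ω') ^ 2)|
      stoppedSigma S m ⊔ sigmaU S]) ω)
    (hnew : ∀ m, (∀ k < m, Uproc S m ω ≠ Uproc S k ω) →
      (1 : ℝ) / 2 ≤ (P[(fun ω' => (MartM S (m + 1) ω' - MartM S m ω') ^ 2)|
        stoppedSigma S m ⊔ sigmaU S]) ω) {a b : ℕ} (hab : a ≤ b) :
    ((rangeCardU S b ω : ℝ) - rangeCardU S a ω - 1) / 2 ≤ quadVarU P S b ω - quadVarU P S a ω := by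
  rw [quadVarU, quadVarU, ← Finset.sum_Ico_eq_sub _ hab]
  have h := rangeCardU_sub_le (S := S) hab ω
  have h2 := Finset.sum_le_sum fun m (_ : m ∈ Finset.Ico a b) =>
    show (if ∀ k < m, Uproc S m ω ≠ Uproc S k ω then (1 : ℝ) else 0) * (1 / 2)
      ≤ (P[(fun ω' => (MartM S (m + 1) ω' - MartM S m ω') ^ 2)|
        stoppedSigma S m ⊔ sigmaU S]) ω by
      split_ifs with hm
      · simpa using hnew m hm
      · simpa using h0 m
  rw [← Finset.sum_mul] at h2
  linarith

end BERW

/-- For the `M₄(2,3)` balanced excited random walk: each time `U` is at a newly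
visited site, `E_U[(M_{n+1} − M_n)² | 𝒢_n] ≥ 1/2`; and for `n` large, for every
`k ∈ 𝒦`, `V_{t_{k+1}} − V_{t_k} ≥ (r_U(t_{k+1}) − r_U(t_k) − 1)/2
≥ (ρ₀/4)(t_{k+1} − t_k)/log n`. -/
theorem berw_M4_2_3_quadratic_variation_bound {Ω : Type*} [MeasurableSpace Ω]
    (P : Measure Ω) [IsProbabilityMeasure P]
    (S : ℕ → Ω → Fin 4 → ℤ) (hS : IsBERW 4 2 3 P S)
    (ρ₀ : ℝ) (hρ₀ : 0 < ρ₀) (hρ₀' : ρ₀ ≤ 1) :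
    (∀ n : ℕ, ∀ᵐ ω ∂P, (∀ k < n, Uproc S n ω ≠ Uproc S k ω) →
      (1 : ℝ) / 2 ≤ (P[(fun ω' => (MartM S (n + 1) ω' - MartM S n ω') ^ 2)|
          stoppedSigma S n ⊔ sigmaU S]) ω) ∧
    (∃ n₁ : ℕ, ∀ n : ℕ, n₁ ≤ n → ∀ᵐ ω ∂P, ∀ k ∈ goodScalesU S ρ₀ n ω,
      ((rangeCardU S (timeIdx n (k + 1)) ω : ℝ)
          - rangeCardU S (timeIdx n k) ω - 1) / 2
        ≤ quadVarU P S (timeIdx n (k + 1)) ω - quadVarU P S (timeIdx n k) ω ∧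
      (ρ₀ / 4) * ((timeIdx n (k + 1) : ℝ) - timeIdx n k) / Real.log n
        ≤ ((rangeCardU S (timeIdx n (k + 1)) ω : ℝ)
            - rangeCardU S (timeIdx n k) ω - 1) / 2) := by

  have hhalf := BERW.half_le_condExp_increment_sq hS
  refine ⟨hhalf, ⌈Real.exp (max 16 (32 / ρ₀))⌉₊, fun n hn => ?_⟩
  have hlog : max 16 (32 / ρ₀) ≤ Real.log n := by
    have hle : Real.exp (max 16 (32 / ρ₀)) ≤ n := Nat.ceil_le.1 hn
    exact (Real.le_log_iff_exp_le ((Real.exp_pos _).trans_le hle)).2 hle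
  have hnonneg : ∀ m, 0 ≤ᵐ[P] P[(fun ω' => (MartM S (m + 1) ω' - MartM S m ω') ^ 2)|
      stoppedSigma S m ⊔ sigmaU S] :=
    fun m => condExp_nonneg (Eventually.of_forall fun _ => sq_nonneg _)
  filter_upwards [ae_all_iff.2 hhalf, ae_all_iff.2 hnonneg] with ω hω hω0 k hk
  refine ⟨BERW.range_le_quadVarU hω0 hω (BERW.timeIdx_le_succ n k), ?_⟩
  rw [goodScalesU, Finset.mem_filter, Finset.mem_Icc] at hk
  have h2 := BERW.two_le_of_mem_goodScalesU hρ₀ ((le_max_left _ _).trans hlog)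
    ((le_max_right _ _).trans hlog) hk.1.2
  have h3 := hk.2
  calc ρ₀ / 4 * ((timeIdx n (k + 1) : ℝ) - timeIdx n k) / Real.log n
      = ρ₀ * ((timeIdx n (k + 1) : ℝ) - timeIdx n k) / Real.log n / 4 := by ring
    _ ≤ _ := by linarith
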